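/- arXiv:2005.13644 — 2 statements merged into one kernel-verified Lean document; each statement's English description precedes it below -/
import Mathlib

section
/- (Mode-reduced Lagrangian estimate, eq. (12).) There exists a constant C̃ > 0, depending only on M, C and s, such that for every integer ℓ ≥ s, every ε with 0 ≤ ε ≤ 1, every pair β^t, β^r satisfying the stated bounds with constant C, and every solution ψ of P_{s,ℓ}ψ = ε(β^t ∂_t ψ + β^r ∂_r ψ) (smooth up to r = 2M, with compact support in r on every compact time interval), one has for all τ > 0: I_ndeg[Wψ](0,τ) ≤ C̃ ( ∫_0^τ ∫_{2M}^∞ (1/(r D)) (∂_t Wψ)² dr dτ̃ + Ī_ndeg[ψ](0,τ) + E[Wψ](τ) + E[Wψ](0) + Ē[ψ](τ) + Ē[ψ](0) ). -/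
open MeasureTheory Set
open scoped ENNReal

noncomputable section

/-- `D(r) = 1 - 2M/r`. -/
def Dc (M r : ℝ) : ℝ := 1 - 2*M/r

/-- `f(r) = (1 - 3M/r) √(1 + 6M/r)`. -/
def fc (M r : ℝ) : ℝ := (1 - 3*M/r) * Real.sqrt (1 + 6*M/r)

/-- Partial derivative in `t`. -/
def pt (ψ : ℝ → ℝ → ℝ) : ℝ → ℝ → ℝ := fun t r => deriv (fun t' => ψ t' r) t

/-- Partial derivative in `r`. -/
def pr (ψ : ℝ → ℝ → ℝ) : ℝ → ℝ → ℝ := fun t r => deriv (fun r' => ψ t r') r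

/-- `R* = (2M/r) ∂_t + D ∂_r`. -/
def Rst (M : ℝ) (ψ : ℝ → ℝ → ℝ) : ℝ → ℝ → ℝ :=
  fun t r => (2*M/r) * pt ψ t r + Dc M r * pr ψ t r

/-- `W = (r/√D)(R* + f T)`. -/
def Wc (M : ℝ) (ψ : ℝ → ℝ → ℝ) : ℝ → ℝ → ℝ :=
  fun t r => (r / Real.sqrt (Dc M r)) * (Rst M ψ t r + fc M r * pt ψ t r)

/-- The mode-reduced Regge--Wheeler operator `P_{s,ℓ}`. -/
def Pc (M : ℝ) (s ℓ : ℕ) (ψ : ℝ → ℝ → ℝ) : ℝ → ℝ → ℝ := fun t r =>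
  (1 + 2*M/r) * pt (pt ψ) t r - (4*M/r) * pt (pr ψ) t r + (2*M/r^2) * pt ψ t r
    - pr (fun t' r' => Dc M r' * pr ψ t' r') t r
    + ((ℓ : ℝ)*((ℓ : ℝ)+1)/r^2) * ψ t r + (1 - (s : ℝ)^2) * (2*M/r^3) * ψ t r

/-- Slice energy `E[ψ](τ)` (degenerate at the horizon). -/
def eE (M : ℝ) (ℓ : ℕ) (ψ : ℝ → ℝ → ℝ) (τ : ℝ) : ℝ≥0∞ :=
  ∫⁻ r in Ioi (2*M), ENNReal.ofReal
    ((pt ψ τ r)^2 + Dc M r * (pr ψ τ r)^2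
      + (ℓ : ℝ)*((ℓ : ℝ)+1)*(ψ τ r)^2/r^2 + (ψ τ r)^2/r^2)

/-- Non-degenerate slice energy `Ē[ψ](τ)`. -/
def eEbar (M : ℝ) (ℓ : ℕ) (ψ : ℝ → ℝ → ℝ) (τ : ℝ) : ℝ≥0∞ :=
  ∫⁻ r in Ioi (2*M), ENNReal.ofReal
    ((pt ψ τ r)^2 + (pr ψ τ r)^2
      + (ℓ : ℝ)*((ℓ : ℝ)+1)*(ψ τ r)^2/r^2 + (ψ τ r)^2/r^2)

/-- Spacetime energy `I_ndeg[ψ](τ₁,τ₂)` (degenerate at the horizon). -/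
def iNdeg (M : ℝ) (ℓ : ℕ) (ψ : ℝ → ℝ → ℝ) (τ₁ τ₂ : ℝ) : ℝ≥0∞ :=
  ∫⁻ τ in Ioc τ₁ τ₂, ∫⁻ r in Ioi (2*M), ENNReal.ofReal
    ((pt ψ τ r)^2/r^2 + Dc M r * (pr ψ τ r)^2/r^2
      + (ℓ : ℝ)*((ℓ : ℝ)+1)*(ψ τ r)^2/r^3 + (ψ τ r)^2/r^3)

/-- Non-degenerate spacetime energy `Ī_ndeg[ψ](τ₁,τ₂)`. -/
def iNdegBar (M : ℝ) (ℓ : ℕ) (ψ : ℝ → ℝ → ℝ) (τ₁ τ₂ : ℝ) : ℝ≥0∞ :=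
  ∫⁻ τ in Ioc τ₁ τ₂, ∫⁻ r in Ioi (2*M), ENNReal.ofReal
    ((pt ψ τ r)^2/r^2 + (pr ψ τ r)^2/r^2
      + (ℓ : ℝ)*((ℓ : ℝ)+1)*(ψ τ r)^2/r^3 + (ψ τ r)^2/r^3)

/-- Spacetime energy `Ī_deg[ψ](τ₁,τ₂)` degenerating at the photon sphere `r = 3M`. -/
def iDegBar (M : ℝ) (ℓ : ℕ) (ψ : ℝ → ℝ → ℝ) (τ₁ τ₂ : ℝ) : ℝ≥0∞ :=
  ∫⁻ τ in Ioc τ₁ τ₂, ∫⁻ r in Ioi (2*M), ENNReal.ofReal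
    ((1 - 3*M/r)^2 * ((pt ψ τ r)^2/r^2 + (pr ψ τ r)^2/r^2
        + (ℓ : ℝ)*((ℓ : ℝ)+1)*(ψ τ r)^2/r^3)
      + (Rst M ψ τ r)^2/r^2 + (ψ τ r)^2/r^3)

/-- Smoothness of a two-variable function on `ℝ × S`. -/
def SmoothOnRegion (ψ : ℝ → ℝ → ℝ) (S : Set ℝ) : Prop :=
  ContDiffOn ℝ (⊤ : ℕ∞) (Function.uncurry ψ) (univ ×ˢ S)

/-- Compact support in `r` on every compact time interval. -/
def CompactRSupport (ψ : ℝ → ℝ → ℝ) : Prop :=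
  ∀ a b : ℝ, ∃ R : ℝ, ∀ t r : ℝ, t ∈ Icc a b → R ≤ r → ψ t r = 0

/-- The pointwise bounds (5) on the perturbation `β = (β^t, β^r)`. -/
def BetaBounds (M C : ℝ) (βt βr : ℝ → ℝ → ℝ) : Prop :=
  ∀ t r : ℝ, 2*M < r →
    r^2 * |βt t r| + r^2 * |βr t r|
      + r ^ ((3:ℝ)/2) * |Wc M βt t r| + r ^ ((3:ℝ)/2) * |Wc M βr t r| ≤ C

/-- `ψ` solves the mode-reduced perturbed Regge--Wheeler equation. -/
def SolvesPerturbedRW (M : ℝ) (s ℓ : ℕ) (ε : ℝ) (βt βr ψ : ℝ → ℝ → ℝ) : Prop :=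
  ∀ t r : ℝ, 2*M < r →
    Pc M s ℓ ψ t r = ε * (βt t r * pt ψ t r + βr t r * pr ψ t r)

open Filter Topology
open scoped ContDiff

/-! ### Partial derivatives of functions that are smooth on `ℝ × (a, ∞)` -/

section Smooth

variable {a : ℝ} {u v : ℝ → ℝ → ℝ} {S : Set ℝ}

lemma isOpen_region (a : ℝ) : IsOpen ((univ : Set ℝ) ×ˢ Ioi a) := isOpen_univ.prod isOpen_Ioi

lemma SmoothOnRegion.contDiffAt (hu : SmoothOnRegion u (Ioi a)) {t r : ℝ} (hr : a < r) :
    ContDiffAt ℝ ∞ (Function.uncurry u) (t, r) :=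
  ContDiffOn.contDiffAt hu ((isOpen_region a).mem_nhds ⟨mem_univ _, hr⟩)

lemma SmoothOnRegion.differentiableAt (hu : SmoothOnRegion u (Ioi a)) {t r : ℝ} (hr : a < r) :
    DifferentiableAt ℝ (Function.uncurry u) (t, r) :=
  (hu.contDiffAt hr).differentiableAt (by simp)

lemma SmoothOnRegion.congr (hu : SmoothOnRegion u S) (h : ∀ t, ∀ r ∈ S, v t r = u t r) :
    SmoothOnRegion v S :=
  ContDiffOn.congr hu fun x hx => h x.1 x.2 hx.2

lemma SmoothOnRegion.mono {S' : Set ℝ} (hu : SmoothOnRegion u S) (h : S' ⊆ S) :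
    SmoothOnRegion u S' :=
  ContDiffOn.mono hu (prod_mono_right h)

lemma SmoothOnRegion.add (hu : SmoothOnRegion u S) (hv : SmoothOnRegion v S) :
    SmoothOnRegion (fun t r => u t r + v t r) S := ContDiffOn.add hu hv

lemma SmoothOnRegion.sub (hu : SmoothOnRegion u S) (hv : SmoothOnRegion v S) :
    SmoothOnRegion (fun t r => u t r - v t r) S := ContDiffOn.sub hu hv

lemma SmoothOnRegion.mul (hu : SmoothOnRegion u S) (hv : SmoothOnRegion v S) :
    SmoothOnRegion (fun t r => u t r * v t r) S := ContDiffOn.mul hu hv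

lemma SmoothOnRegion.const (c : ℝ) : SmoothOnRegion (fun _ _ => c) S := contDiffOn_const

lemma SmoothOnRegion.radial {h : ℝ → ℝ} (hh : ContDiffOn ℝ ∞ h S) :
    SmoothOnRegion (fun _ r => h r) S :=
  hh.comp contDiffOn_snd fun _ hx => hx.2

lemma pt_eq_fderiv {t r : ℝ} (hu : DifferentiableAt ℝ (Function.uncurry u) (t, r)) :
    HasDerivAt (fun t' => u t' r) (fderiv ℝ (Function.uncurry u) (t, r) (1, 0)) t := by
  have h1 : HasDerivAt (fun t' : ℝ => ((t', r) : ℝ × ℝ)) (1, 0) t :=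
    (hasDerivAt_id t).prodMk (hasDerivAt_const t r)
  exact hu.hasFDerivAt.comp_hasDerivAt t h1

lemma pr_eq_fderiv {t r : ℝ} (hu : DifferentiableAt ℝ (Function.uncurry u) (t, r)) :
    HasDerivAt (fun r' => u t r') (fderiv ℝ (Function.uncurry u) (t, r) (0, 1)) r := by
  have h1 : HasDerivAt (fun r' : ℝ => ((t, r') : ℝ × ℝ)) (0, 1) r :=
    (hasDerivAt_const r t).prodMk (hasDerivAt_id r)
  exact hu.hasFDerivAt.comp_hasDerivAt r h1

lemma SmoothOnRegion.hasDerivAt_pt (hu : SmoothOnRegion u (Ioi a)) {t r : ℝ} (hr : a < r) :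
    HasDerivAt (fun t' => u t' r) (pt u t r) t :=
  (pt_eq_fderiv (hu.differentiableAt hr)).differentiableAt.hasDerivAt

lemma SmoothOnRegion.hasDerivAt_pr (hu : SmoothOnRegion u (Ioi a)) {t r : ℝ} (hr : a < r) :
    HasDerivAt (fun r' => u t r') (pr u t r) r :=
  (pr_eq_fderiv (hu.differentiableAt hr)).differentiableAt.hasDerivAt

lemma SmoothOnRegion.pt_eq (hu : SmoothOnRegion u (Ioi a)) {t r : ℝ} (hr : a < r) :
    pt u t r = fderiv ℝ (Function.uncurry u) (t, r) (1, 0) :=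
  (pt_eq_fderiv (hu.differentiableAt hr)).deriv

lemma SmoothOnRegion.pr_eq (hu : SmoothOnRegion u (Ioi a)) {t r : ℝ} (hr : a < r) :
    pr u t r = fderiv ℝ (Function.uncurry u) (t, r) (0, 1) :=
  (pr_eq_fderiv (hu.differentiableAt hr)).deriv

/-- Up to a boundary, the time derivative extends smoothly. -/
lemma SmoothOnRegion.exists_pt_extension (hu : SmoothOnRegion u (Ici a)) :
    ∃ v, SmoothOnRegion v (Ici a) ∧ ∀ t r, a < r → pt u t r = v t r := by
  refine ⟨fun t r => fderivWithin ℝ (Function.uncurry u) (univ ×ˢ Ici a) (t, r) (1, 0), ?_, ?_⟩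
  · exact (ContDiffOn.fderivWithin (m := ∞) hu (uniqueDiffOn_univ.prod (uniqueDiffOn_Ici a))
      le_rfl).clm_apply contDiffOn_const
  · intro t r hr
    rw [(hu.mono Ioi_subset_Ici_self).pt_eq hr]
    simp only [fderivWithin_of_mem_nhds (prod_mem_nhds (univ_mem (f := 𝓝 t)) (Ici_mem_nhds hr))]

/-- Up to a boundary, the radial derivative extends smoothly. -/
lemma SmoothOnRegion.exists_pr_extension (hu : SmoothOnRegion u (Ici a)) :
    ∃ v, SmoothOnRegion v (Ici a) ∧ ∀ t r, a < r → pr u t r = v t r := by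
  refine ⟨fun t r => fderivWithin ℝ (Function.uncurry u) (univ ×ˢ Ici a) (t, r) (0, 1), ?_, ?_⟩
  · exact (ContDiffOn.fderivWithin (m := ∞) hu (uniqueDiffOn_univ.prod (uniqueDiffOn_Ici a))
      le_rfl).clm_apply contDiffOn_const
  · intro t r hr
    rw [(hu.mono Ioi_subset_Ici_self).pr_eq hr]
    simp only [fderivWithin_of_mem_nhds (prod_mem_nhds (univ_mem (f := 𝓝 t)) (Ici_mem_nhds hr))]

lemma SmoothOnRegion.pt (hu : SmoothOnRegion u (Ioi a)) : SmoothOnRegion (pt u) (Ioi a) := by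
  have h : ContDiffOn ℝ ∞ (fun x => fderiv ℝ (Function.uncurry u) x (1, 0)) (univ ×ˢ Ioi a) :=
    (ContDiffOn.fderiv_of_isOpen (m := ∞) hu (isOpen_region a) le_rfl).clm_apply contDiffOn_const
  exact h.congr fun x hx => hu.pt_eq hx.2

lemma SmoothOnRegion.pr (hu : SmoothOnRegion u (Ioi a)) : SmoothOnRegion (pr u) (Ioi a) := by
  have h : ContDiffOn ℝ ∞ (fun x => fderiv ℝ (Function.uncurry u) x (0, 1)) (univ ×ˢ Ioi a) :=
    (ContDiffOn.fderiv_of_isOpen (m := ∞) hu (isOpen_region a) le_rfl).clm_apply contDiffOn_const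
  exact h.congr fun x hx => hu.pr_eq hx.2

lemma pt_congr (h : ∀ t r, a < r → u t r = v t r) {t r : ℝ} (hr : a < r) :
    pt u t r = pt v t r := by
  have : (fun t' => u t' r) = fun t' => v t' r := funext fun t' => h t' r hr
  simp only [_root_.pt, this]

lemma pr_congr (h : ∀ t r, a < r → u t r = v t r) {t r : ℝ} (hr : a < r) :
    pr u t r = pr v t r := by
  apply Filter.EventuallyEq.deriv_eq
  filter_upwards [Ioi_mem_nhds hr] with r' hr' using h t r' hr'

lemma SmoothOnRegion.pt_pr (hu : SmoothOnRegion u (Ioi a)) {t r : ℝ} (hr : a < r) :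
    _root_.pt (_root_.pr u) t r = _root_.pr (_root_.pt u) t r := by
  set g := fderiv ℝ (Function.uncurry u) with hg
  have hd : DifferentiableAt ℝ g (t, r) :=
    ((hu.contDiffAt hr).fderiv_right (m := 1) (by norm_cast)).differentiableAt (by simp)
  have h1 : HasDerivAt (fun t' : ℝ => ((t', r) : ℝ × ℝ)) (1, 0) t :=
    (hasDerivAt_id t).prodMk (hasDerivAt_const t r)
  have h2 : HasDerivAt (fun r' : ℝ => ((t, r') : ℝ × ℝ)) (0, 1) r :=
    (hasDerivAt_const r t).prodMk (hasDerivAt_id r)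
  have e1 : HasDerivAt (fun t' => g (t', r) (0, 1)) (fderiv ℝ g (t, r) (1, 0) (0, 1)) t := by
    have h : HasDerivAt (fun t' => g (t', r)) (fderiv ℝ g (t, r) (1, 0)) t :=
      hd.hasFDerivAt.comp_hasDerivAt t h1
    simpa using h.clm_apply (hasDerivAt_const t ((0, 1) : ℝ × ℝ))
  have e2 : HasDerivAt (fun r' => g (t, r') (1, 0)) (fderiv ℝ g (t, r) (0, 1) (1, 0)) r := by
    have h : HasDerivAt (fun r' => g (t, r')) (fderiv ℝ g (t, r) (0, 1)) r :=
      hd.hasFDerivAt.comp_hasDerivAt r h2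
    simpa using h.clm_apply (hasDerivAt_const r ((1, 0) : ℝ × ℝ))
  have e3 : _root_.pt (_root_.pr u) t r = fderiv ℝ g (t, r) (1, 0) (0, 1) :=
    (pt_congr (v := fun t r => g (t, r) (0, 1)) (fun t r hr => hu.pr_eq hr) hr).trans e1.deriv
  have e4 : _root_.pr (_root_.pt u) t r = fderiv ℝ g (t, r) (0, 1) (1, 0) :=
    (pr_congr (v := fun t r => g (t, r) (1, 0)) (fun t r hr => hu.pt_eq hr) hr).trans e2.deriv
  rw [e3, e4]
  exact (hu.contDiffAt hr).isSymmSndFDerivAt (by simp; norm_cast) _ _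

/-- A function smooth up to the boundary is bounded on compact sets. -/
lemma SmoothOnRegion.exists_bound (hu : SmoothOnRegion u (Ici a)) (t₁ t₂ R : ℝ) :
    ∃ K, ∀ t ∈ Icc t₁ t₂, ∀ r ∈ Icc a R, |u t r| ≤ K := by
  obtain ⟨K, hK⟩ := (isCompact_Icc.prod isCompact_Icc :
    IsCompact (Icc t₁ t₂ ×ˢ Icc a R)).exists_bound_of_continuousOn
    ((ContDiffOn.continuousOn hu).mono (prod_mono (subset_univ _) Icc_subset_Ici_self))
  exact ⟨K, fun t ht r hr => hK (t, r) ⟨ht, hr⟩⟩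

end Smooth

/-! ### The radial coefficients of `W` -/

section Radial

/-- `√D`. -/
def qc (M r : ℝ) : ℝ := Real.sqrt (Dc M r)

/-- `√(1 + 6M/r)`. -/
def pc (M r : ℝ) : ℝ := Real.sqrt (1 + 6*M/r)

/-- The coefficient in `W = r√D (α ∂_t + ∂_r)`. -/
def alphac (M r : ℝ) : ℝ := (3 * pc M r^2 + 4 * pc M r - 1) / (2 * (2 + pc M r))

/-- The derivative of `r√D`. -/
def bc1 (M r : ℝ) : ℝ := qc M r + M / (r * qc M r)

/-- The derivative of `alphac`. -/
def alphac1 (M r : ℝ) : ℝ := (3/2 - 3/(2 * (2 + pc M r)^2)) * (-3 * M / (r^2 * pc M r))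

/-- The second derivative of `alphac`. -/
def alphac2 (M r : ℝ) : ℝ :=
  3 / (2 + pc M r)^3 * (9 * M^2 / (r^4 * pc M r^2)) +
    (3/2 - 3/(2 * (2 + pc M r)^2)) * (6 * M / (r^3 * pc M r) - 9 * M^2 / (r^4 * pc M r^3))

variable {M r : ℝ}

lemma Dc_pos (hM : 0 < M) (hr : 2*M < r) : 0 < Dc M r := by
  have : 0 < r := by linarith
  rw [Dc, sub_pos, div_lt_one this]
  exact hr

lemma qc_pos (hM : 0 < M) (hr : 2*M < r) : 0 < qc M r := Real.sqrt_pos.2 (Dc_pos hM hr)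

lemma qc_sq (hM : 0 < M) (hr : 2*M < r) : qc M r^2 = 1 - 2*M/r := Real.sq_sqrt (Dc_pos hM hr).le

lemma pc_sq (hM : 0 < M) (hr : 2*M < r) : pc M r^2 = 1 + 6*M/r := by
  have : 0 < r := by linarith
  exact Real.sq_sqrt (by positivity)

lemma one_lt_pc (hM : 0 < M) (hr : 2*M < r) : 1 < pc M r := by
  have h : 0 < r := by linarith
  rw [pc, Real.lt_sqrt (by norm_num)]
  have : 0 < 6*M/r := by positivity
  linarith

lemma pc_lt_two (hM : 0 < M) (hr : 2*M < r) : pc M r < 2 := by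
  have h := qc_sq hM hr
  have h' := pc_sq hM hr
  have h'' := qc_pos hM hr
  have e : 6*M/r = 3 * (2*M/r) := by ring
  nlinarith

lemma eq_mass (hM : 0 < M) (hr : 2*M < r) : M = r * (pc M r^2 - 1) / 6 := by
  have : r ≠ 0 := by linarith
  rw [pc_sq hM hr]
  field_simp
  ring

lemma qc_sq' (hM : 0 < M) (hr : 2*M < r) : qc M r^2 = (4 - pc M r^2) / 3 := by
  rw [qc_sq hM hr, pc_sq hM hr]
  ring

lemma hasDerivAt_Dc (hr : r ≠ 0) : HasDerivAt (Dc M) (2*M/r^2) r := by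
  have h := ((hasDerivAt_inv hr).const_mul (2*M)).const_sub 1
  have e : Dc M = fun r => 1 - 2*M*r⁻¹ := funext fun r => by rw [Dc, div_eq_mul_inv]
  rw [e]
  exact h.congr_deriv (by field_simp)

lemma hasDerivAt_qc (hM : 0 < M) (hr : 2*M < r) : HasDerivAt (qc M) (M/(r^2 * qc M r)) r := by
  have hr0 : r ≠ 0 := by linarith
  have hq := (qc_pos hM hr).ne'
  have h := (hasDerivAt_Dc (M := M) hr0).sqrt (Dc_pos hM hr).ne'
  refine h.congr_deriv ?_
  change 2*M/r^2 / (2 * qc M r) = _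
  field_simp

lemma hasDerivAt_pc (hM : 0 < M) (hr : 2*M < r) :
    HasDerivAt (pc M) (-3*M/(r^2 * pc M r)) r := by
  have hr0 : 0 < r := by linarith
  have hp : pc M r ≠ 0 := by linarith [one_lt_pc hM hr]
  have h := (((hasDerivAt_inv hr0.ne').const_mul (6*M)).const_add 1).sqrt
    (by positivity)
  have e : pc M = fun r => Real.sqrt (1 + 6*M*r⁻¹) :=
    funext fun r => by rw [pc, div_eq_mul_inv]
  have e' : Real.sqrt (1 + 6*M*r⁻¹) = pc M r := by rw [e]
  rw [e'] at h
  rw [e]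
  refine h.congr_deriv ?_
  rw [← e]
  field_simp
  norm_num

lemma hasDerivAt_bc (hM : 0 < M) (hr : 2*M < r) :
    HasDerivAt (fun r => r * qc M r) (bc1 M r) r := by
  have hr0 : r ≠ 0 := by linarith
  have hq := (qc_pos hM hr).ne'
  refine ((hasDerivAt_id r).mul (hasDerivAt_qc hM hr)).congr_deriv ?_
  simp only [id, bc1]
  field_simp

lemma hasDerivAt_bc1 (hM : 0 < M) (hr : 2*M < r) :
    HasDerivAt (bc1 M) (-M^2/(r^3 * qc M r^3)) r := by
  have hr0 : r ≠ 0 := by linarith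
  have hq := (qc_pos hM hr).ne'
  refine ((hasDerivAt_qc hM hr).add ((hasDerivAt_const r M).div
    ((hasDerivAt_id r).mul (hasDerivAt_qc hM hr)) (mul_ne_zero hr0 hq))).congr_deriv ?_
  simp only [id, Pi.mul_apply]
  field_simp
  ring

lemma hasDerivAt_alphac (hM : 0 < M) (hr : 2*M < r) :
    HasDerivAt (alphac M) (alphac1 M r) r := by
  have hr0 : r ≠ 0 := by linarith
  have hp1 := one_lt_pc hM hr
  have hp : pc M r ≠ 0 := by linarith
  have hp2 : 2 + pc M r ≠ 0 := by linarith
  have h := hasDerivAt_pc hM hr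
  refine (((((h.pow 2).const_mul 3).add (h.const_mul 4)).sub_const 1).div
    ((h.const_add 2).const_mul 2) (mul_ne_zero two_ne_zero hp2)).congr_deriv ?_
  simp only [alphac1, Pi.pow_apply, Pi.add_apply]
  field_simp
  ring

lemma hasDerivAt_alphac1 (hM : 0 < M) (hr : 2*M < r) :
    HasDerivAt (alphac1 M) (alphac2 M r) r := by
  have hr0 : r ≠ 0 := by linarith
  have hp1 := one_lt_pc hM hr
  have hp : pc M r ≠ 0 := by linarith
  have hp2 : 2 + pc M r ≠ 0 := by linarith
  have h := hasDerivAt_pc hM hr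
  refine ((((hasDerivAt_const r (3:ℝ)).div (((h.const_add 2).pow 2).const_mul 2)
    (mul_ne_zero two_ne_zero (pow_ne_zero 2 hp2))).const_sub (3/2)).mul
    ((hasDerivAt_const r (-3*M)).div (((hasDerivAt_id r).pow 2).mul h)
      (mul_ne_zero (pow_ne_zero 2 hr0) hp))).congr_deriv ?_
  simp only [alphac2, Pi.pow_apply, Pi.mul_apply, Pi.div_apply, id]
  field_simp
  ring

lemma contDiffOn_inv_r (hM : 0 < M) : ContDiffOn ℝ ∞ (fun r : ℝ => r⁻¹) (Ioi (2*M)) :=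
  contDiffOn_id.inv fun r hr => by
    have : 2*M < r := hr
    simp only [id]
    linarith

lemma contDiffOn_Dc (hM : 0 < M) : ContDiffOn ℝ ∞ (Dc M) (Ioi (2*M)) :=
  contDiffOn_const.sub (contDiffOn_const.mul (contDiffOn_inv_r hM))

lemma contDiffOn_qc (hM : 0 < M) : ContDiffOn ℝ ∞ (qc M) (Ioi (2*M)) :=
  (contDiffOn_Dc hM).sqrt fun _ hr => (Dc_pos hM hr).ne'

lemma contDiffOn_alphac (hM : 0 < M) : ContDiffOn ℝ ∞ (alphac M) (Ioi (2*M)) := by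
  have h : ContDiffOn ℝ ∞ (pc M) (Ioi (2*M)) :=
    (contDiffOn_const.add (contDiffOn_const.mul (contDiffOn_inv_r hM))).sqrt fun r hr => by
      have h1 : 2*M < r := hr
      have : 0 < r := by linarith
      positivity
  exact (((contDiffOn_const.mul (h.pow 2)).add (contDiffOn_const.mul h)).sub
    contDiffOn_const).div (contDiffOn_const.mul (contDiffOn_const.add h)) fun r hr => by
      have := one_lt_pc hM hr
      positivity

lemma Wc_eq (hM : 0 < M) (hr : 2*M < r) (u : ℝ → ℝ → ℝ) (t : ℝ) :
    Wc M u t r = r * qc M r * (alphac M r * pt u t r + pr u t r) := by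
  have hr0 : 0 < r := by linarith
  have hp1 := one_lt_pc hM hr
  have hq := qc_pos hM hr
  have hD : Dc M r = qc M r^2 := (qc_sq hM hr).symm
  have key : 2*M/r + (1 - 3*M/r) * pc M r = qc M r^2 * alphac M r := by
    have h2 : 2 + pc M r ≠ 0 := by linarith
    have hx : M/r = (pc M r^2 - 1)/6 := by rw [pc_sq hM hr]; ring
    rw [qc_sq' hM hr, alphac, mul_div_assoc, mul_div_assoc, hx]
    field_simp
    ring
  have e : Wc M u t r = (r / qc M r) *
      ((2*M/r + (1 - 3*M/r) * pc M r) * pt u t r + qc M r^2 * pr u t r) := by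
    rw [← hD]
    simp only [Wc, Rst, fc, qc, pc]
    ring
  rw [e, key]
  field_simp

end Radial

/-! ### Commuting the wave operator with `W` -/

section Commutator

variable {M r : ℝ} {u : ℝ → ℝ → ℝ}

lemma SmoothOnRegion.Wc (hM : 0 < M) (hu : SmoothOnRegion u (Ioi (2*M))) :
    SmoothOnRegion (Wc M u) (Ioi (2*M)) := by
  have hb : SmoothOnRegion (fun _ r => r * qc M r) (Ioi (2*M)) :=
    .radial (contDiffOn_id.mul (contDiffOn_qc hM))
  exact (hb.mul (((SmoothOnRegion.radial (contDiffOn_alphac hM)).mul hu.pt).add hu.pr)).congr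
    fun t r hr => Wc_eq hM hr u t

lemma pt_Wc (hM : 0 < M) (hu : SmoothOnRegion u (Ioi (2*M))) (hr : 2*M < r) (t : ℝ) :
    pt (Wc M u) t r = Wc M (pt u) t r := by
  rw [pt_congr (fun t r hr => Wc_eq hM hr u t) hr, Wc_eq hM hr, ← hu.pt_pr hr]
  exact (((hu.pt.hasDerivAt_pt hr).const_mul _).add (hu.pr.hasDerivAt_pt hr)).const_mul _ |>.deriv

lemma pr_Wc (hM : 0 < M) (hu : SmoothOnRegion u (Ioi (2*M))) (hr : 2*M < r) (t : ℝ) :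
    pr (Wc M u) t r = bc1 M r * (alphac M r * pt u t r + pr u t r) +
      r * qc M r * (alphac1 M r * pt u t r + alphac M r * pr (pt u) t r + pr (pr u) t r) := by
  rw [pr_congr (fun t r hr => Wc_eq hM hr u t) hr]
  exact ((hasDerivAt_bc hM hr).mul (((hasDerivAt_alphac hM hr).mul (hu.pt.hasDerivAt_pr hr)).add
    (hu.pr.hasDerivAt_pr hr))).deriv

lemma pr_pr_Wc (hM : 0 < M) (hu : SmoothOnRegion u (Ioi (2*M))) (hr : 2*M < r) (t : ℝ) :
    pr (pr (Wc M u)) t r =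
      -M^2/(r^3 * qc M r^3) * (alphac M r * pt u t r + pr u t r) +
      2 * bc1 M r * (alphac1 M r * pt u t r + alphac M r * pr (pt u) t r + pr (pr u) t r) +
      r * qc M r * (alphac2 M r * pt u t r + 2 * alphac1 M r * pr (pt u) t r +
        alphac M r * pr (pr (pt u)) t r + pr (pr (pr u)) t r) := by
  rw [pr_congr (fun t r hr => pr_Wc hM hu hr t) hr]
  have ha := hasDerivAt_alphac hM hr
  have ha1 := hasDerivAt_alphac1 hM hr
  have hb := hasDerivAt_bc hM hr
  have hb1 := hasDerivAt_bc1 hM hr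
  have hut := hu.pt.hasDerivAt_pr (t := t) hr
  have hur := hu.pr.hasDerivAt_pr (t := t) hr
  have hutr := hu.pt.pr.hasDerivAt_pr (t := t) hr
  have hurr := hu.pr.pr.hasDerivAt_pr (t := t) hr
  refine ((hb1.mul ((ha.mul hut).add hur)).add
    (hb.mul (((ha1.mul hut).add (ha.mul hutr)).add hurr))).deriv.trans ?_
  simp only [Pi.mul_apply, Pi.add_apply]
  ring

lemma Pc_eq (s ℓ : ℕ) (hM : 0 < M) (hu : SmoothOnRegion u (Ioi (2*M))) (hr : 2*M < r) (t : ℝ) :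
    Pc M s ℓ u t r = (1 + 2*M/r) * pt (pt u) t r - (4*M/r) * pr (pt u) t r + (2*M/r^2) * pt u t r
      - ((2*M/r^2) * pr u t r + Dc M r * pr (pr u) t r)
      + ((ℓ : ℝ)*((ℓ : ℝ)+1)/r^2) * u t r + (1 - (s : ℝ)^2) * (2*M/r^3) * u t r := by
  have h : pr (fun t' r' => Dc M r' * pr u t' r') t r =
      (2*M/r^2) * pr u t r + Dc M r * pr (pr u) t r :=
    ((hasDerivAt_Dc (by linarith)).mul (hu.pr.hasDerivAt_pr hr)).deriv
  rw [Pc, h, hu.pt_pr hr]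

lemma pt_Pc (s ℓ : ℕ) (hM : 0 < M) (hu : SmoothOnRegion u (Ioi (2*M))) (hr : 2*M < r) (t : ℝ) :
    pt (Pc M s ℓ u) t r = (1 + 2*M/r) * pt (pt (pt u)) t r - (4*M/r) * pr (pt (pt u)) t r
      + (2*M/r^2) * pt (pt u) t r
      - ((2*M/r^2) * pr (pt u) t r + Dc M r * pr (pr (pt u)) t r)
      + ((ℓ : ℝ)*((ℓ : ℝ)+1)/r^2) * pt u t r + (1 - (s : ℝ)^2) * (2*M/r^3) * pt u t r := by
  rw [pt_congr (fun t r hr => Pc_eq s ℓ hM hu hr t) hr]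
  have e1 := hu.pt_pr (t := t) hr
  have e2 := hu.pt.pt_pr (t := t) hr
  have e3 : pt (pr (pr u)) t r = pr (pr (pt u)) t r :=
    (hu.pr.pt_pr hr).trans (pr_congr (fun t r hr => hu.pt_pr hr) hr)
  rw [← e1, ← e2, ← e3]
  exact (((((((hu.pt.pt.hasDerivAt_pt hr).const_mul _).sub
    ((hu.pt.pr.hasDerivAt_pt hr).const_mul _)).add ((hu.pt.hasDerivAt_pt hr).const_mul _)).sub
    (((hu.pr.hasDerivAt_pt hr).const_mul _).add ((hu.pr.pr.hasDerivAt_pt hr).const_mul _))).add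
    ((hu.hasDerivAt_pt hr).const_mul _)).add ((hu.hasDerivAt_pt hr).const_mul _)).deriv

lemma hasDerivAt_const_div_pow (c : ℝ) (n : ℕ) (hr : r ≠ 0) :
    HasDerivAt (fun r => c / r^n) (-(n * c) / r^(n+1)) r := by
  refine ((hasDerivAt_const r c).div (hasDerivAt_pow n r) (pow_ne_zero n hr)).congr_deriv ?_
  rcases n with _ | n
  · simp
  · simp only [Nat.add_sub_cancel]
    field_simp
    ring

lemma pr_Pc (s ℓ : ℕ) (hM : 0 < M) (hu : SmoothOnRegion u (Ioi (2*M))) (hr : 2*M < r) (t : ℝ) :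
    pr (Pc M s ℓ u) t r = -(2*M/r^2) * pt (pt u) t r + (1 + 2*M/r) * pr (pt (pt u)) t r
      + (4*M/r^2) * pr (pt u) t r - (4*M/r) * pr (pr (pt u)) t r
      - (4*M/r^3) * pt u t r + (2*M/r^2) * pr (pt u) t r
      + (4*M/r^3) * pr u t r - (4*M/r^2) * pr (pr u) t r - Dc M r * pr (pr (pr u)) t r
      - (2 * ((ℓ : ℝ)*((ℓ : ℝ)+1))/r^3) * u t r + ((ℓ : ℝ)*((ℓ : ℝ)+1)/r^2) * pr u t r
      - (1 - (s : ℝ)^2) * (6*M/r^4) * u t r + (1 - (s : ℝ)^2) * (2*M/r^3) * pr u t r := by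
  rw [pr_congr (fun t r hr => Pc_eq s ℓ hM hu hr t) hr]
  have hr0 : r ≠ 0 := by linarith
  have k1 (c : ℝ) : HasDerivAt (fun r => c / r) (-c / r^2) r := by
    simpa using hasDerivAt_const_div_pow c 1 hr0
  refine (((((((((k1 (2*M)).const_add 1).mul (hu.pt.pt.hasDerivAt_pr hr)).sub
    ((k1 (4*M)).mul (hu.pt.pr.hasDerivAt_pr hr))).add
    ((hasDerivAt_const_div_pow (2*M) 2 hr0).mul (hu.pt.hasDerivAt_pr hr))).sub
    (((hasDerivAt_const_div_pow (2*M) 2 hr0).mul (hu.pr.hasDerivAt_pr hr)).add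
      ((hasDerivAt_Dc hr0).mul (hu.pr.pr.hasDerivAt_pr hr)))).add
    ((hasDerivAt_const_div_pow ((ℓ : ℝ)*((ℓ : ℝ)+1)) 2 hr0).mul (hu.hasDerivAt_pr hr))).add
    (((hasDerivAt_const_div_pow (2*M) 3 hr0).const_mul (1 - (s : ℝ)^2)).mul
      (hu.hasDerivAt_pr hr)))).deriv.trans ?_
  push_cast
  ring

/-- The coefficient of `∂_t ψ` in the commutator. -/
def kappac (M r : ℝ) : ℝ :=
  (pc M r^6 + 2 * pc M r^5 - 2 * pc M r^4 - 4 * pc M r^3 - 3 * pc M r^2 + 6 * pc M r + 12) /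
    (2 * pc M r^3 * (2 + pc M r))

lemma Pc_Wc (s ℓ : ℕ) (hM : 0 < M) (hu : SmoothOnRegion u (Ioi (2*M))) (hr : 2*M < r) (t : ℝ) :
    Pc M s ℓ (Wc M u) t r = Wc M (Pc M s ℓ u) t r + 2 * qc M r * Pc M s ℓ u t r
      - 2 / (r * qc M r^2 * pc M r) * pt (Wc M u) t r
      - M / (r^2 * qc M r) * ((2 - 3*M/r) * pr u t r + kappac M r * pt u t r)
      + (1 - (s : ℝ)^2) * (2 * M * qc M r / r^3) * u t r := by
  have hW := hu.Wc hM
  have e1 : pt (Wc M u) t r = r * qc M r * (alphac M r * pt (pt u) t r + pr (pt u) t r) := by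
    rw [pt_Wc hM hu hr, Wc_eq hM hr]
  have e2 : pt (pt (Wc M u)) t r =
      r * qc M r * (alphac M r * pt (pt (pt u)) t r + pr (pt (pt u)) t r) := by
    rw [pt_congr (fun t r hr => pt_Wc hM hu hr t) hr, pt_Wc hM hu.pt hr, Wc_eq hM hr]
  have e3 : pr (pt (Wc M u)) t r = _ :=
    (pr_congr (fun t r hr => pt_Wc hM hu hr t) hr).trans (pr_Wc hM hu.pt hr t)
  rw [Pc_eq s ℓ hM hW hr, e2, e3, pr_pr_Wc hM hu hr, pr_Wc hM hu hr, e1, Wc_eq hM hr u,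
    Wc_eq hM hr (Pc M s ℓ u), pt_Pc s ℓ hM hu hr, pr_Pc s ℓ hM hu hr, Pc_eq s ℓ hM hu hr]
  have hr0 : r ≠ 0 := by linarith
  have hp1 := one_lt_pc hM hr
  have hp2 := pc_lt_two hM hr
  have hq := (qc_pos hM hr).ne'
  have hD : Dc M r = qc M r^2 := (qc_sq hM hr).symm
  have hM' := eq_mass hM hr
  have hq2 := qc_sq' hM hr
  have h4 : 4 - pc M r^2 ≠ 0 := by nlinarith
  have hq3 : qc M r^3 = qc M r * ((4 - pc M r^2)/3) := by rw [← hq2]; ring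
  have hqi : (qc M r)⁻¹ = qc M r * (3 / (4 - pc M r^2)) := by
    have : (4 - pc M r^2) = 3 * qc M r^2 := by rw [hq2]; ring
    rw [this]
    field_simp
  have hb1 : bc1 M r = qc M r * (1 + (pc M r^2 - 1) / (2 * (4 - pc M r^2))) := by
    have : bc1 M r = qc M r + M / r * (qc M r)⁻¹ := by
      rw [bc1]
      field_simp
    have hx : M / r = (pc M r^2 - 1) / 6 := by rw [pc_sq hM hr]; ring
    rw [this, hqi, hx]
    field_simp
    ring
  rw [hD, hb1, hq3, hq2, alphac2, alphac1, alphac, kappac]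
  rw [show M / (r^2 * qc M r) = M / r^2 * (qc M r)⁻¹ by field_simp, hqi]
  rw [show -M^2 / (r^3 * (qc M r * ((4 - pc M r^2)/3))) =
    -M^2 / (r^3 * ((4 - pc M r^2)/3)) * (qc M r)⁻¹ by field_simp, hqi]
  have h5 : pc M r ≠ 0 := by linarith
  have h6 : 2 + pc M r ≠ 0 := by linarith
  clear hqi hq3 hq2 hD hb1 e1 e2 e3 hW hu hp1 hp2
  generalize pc M r = p at *
  generalize qc M r = q at *
  generalize pt (pt (pt u)) t r = Uttt
  generalize pr (pt (pt u)) t r = Uttr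
  generalize pr (pr (pt u)) t r = Utrr
  generalize pr (pr (pr u)) t r = Urrr
  generalize pt (pt u) t r = Utt
  generalize pr (pt u) t r = Utr
  generalize pr (pr u) t r = Urr
  generalize pt u t r = Ut
  generalize pr u t r = Ur
  generalize u t r = U
  generalize (ℓ : ℝ) * ((ℓ : ℝ) + 1) = L
  subst hM'
  field_simp
  ring

end Commutator

/-! ### Absorbing the error terms -/

section Absorb

lemma abs_mul_mul_le {c K : ℝ} (h : |c| ≤ K) (x y : ℝ) : |c * x * y| ≤ K * (x^2 + y^2) := by
  have hK : 0 ≤ K := (abs_nonneg c).trans h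
  have h1 : |x| * |y| ≤ x^2 + y^2 := by
    nlinarith [sq_abs x, sq_abs y, sq_nonneg (|x| - |y|), sq_nonneg x, sq_nonneg y]
  rw [mul_assoc, abs_mul, abs_mul]
  exact mul_le_mul h h1 (by positivity) hK

lemma abs_mul_mul_le_small {c K δ : ℝ} (h : |c| ≤ K) (hδ : 0 < δ) (x y : ℝ) :
    |c * x * y| ≤ δ * x^2 + K^2 / (4 * δ) * y^2 := by
  have hK : 0 ≤ K := (abs_nonneg c).trans h
  have h1 : |c * x * y| ≤ K * (|x| * |y|) := by
    rw [mul_assoc, abs_mul, abs_mul]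
    exact mul_le_mul_of_nonneg_right h (by positivity)
  refine h1.trans ?_
  have h2 : δ * x^2 + K^2 / (4 * δ) * y^2 - K * (|x| * |y|)
      = (2 * δ * |x| - K * |y|)^2 / (4 * δ) := by
    rw [← sq_abs x, ← sq_abs y]
    field_simp
    ring
  have h3 : 0 ≤ (2 * δ * |x| - K * |y|)^2 / (4 * δ) := by positivity
  linarith

lemma abs_mul_mul_le_eighth {c K : ℝ} (h : |c| ≤ K) (x y : ℝ) :
    |c * x * y| ≤ x^2 / 8 + 2 * K^2 * y^2 := by
  have := abs_mul_mul_le_small h (by norm_num : (0:ℝ) < 1/8) x y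
  calc _ ≤ _ := this
    _ = _ := by ring

/-- Lower bound for a quadratic form whose leading part is `a²`, where `y'²` exceeds `y²` by
a multiple of `m²`, and `m² ≤ 10 (n₁² + n₂²)`. -/
lemma quadratic_form_lower_bound {M K a y y' z n₁ n₂ m v : ℝ}
    {c₁ c₂ c₃ c₄ c₅ c₆ c₇ c₈ c₉ d₁ d₂ d₃ d₄ : ℝ} (hM : 0 < M) (hm : m^2 ≤ 10 * (n₁^2 + n₂^2))
    (hy : y'^2 = y^2 + 2 * M * m^2)
    (h₁ : |c₁| ≤ K) (h₂ : |c₂| ≤ K) (h₃ : |c₃| ≤ K) (h₄ : |c₄| ≤ K) (h₅ : |c₅| ≤ K)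
    (h₆ : |c₆| ≤ K) (h₇ : |c₇| ≤ K) (h₈ : |c₈| ≤ K) (h₉ : |c₉| ≤ K)
    (k₁ : |d₁| ≤ K) (k₂ : |d₂| ≤ K) (k₃ : |d₃| ≤ K) (k₄ : |d₄| ≤ K) :
    a^2 / 2 - (50 * K + 20 * M * K + 20 * K^2) * (y^2 + z^2 + (n₁^2 + n₂^2) + v^2) ≤
      a^2 + c₁ * y * n₁ + c₂ * y * n₂ + c₃ * y * z + c₄ * a * m + c₅ * m * m + c₆ * m * n₁
        + c₇ * m * n₂ + c₈ * y' * z + c₉ * v * y + d₁ * y * y + d₂ * z * z + d₃ * a * z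
        + d₄ * a * y := by
  have hK : 0 ≤ K := (abs_nonneg _).trans h₁
  have e₁ := neg_le_of_abs_le (abs_mul_mul_le h₁ y n₁)
  have e₂ := neg_le_of_abs_le (abs_mul_mul_le h₂ y n₂)
  have e₃ := neg_le_of_abs_le (abs_mul_mul_le h₃ y z)
  have e₄ := neg_le_of_abs_le (abs_mul_mul_le_eighth h₄ a m)
  have e₅ := neg_le_of_abs_le (abs_mul_mul_le h₅ m m)
  have e₆ := neg_le_of_abs_le (abs_mul_mul_le h₆ m n₁)
  have e₇ := neg_le_of_abs_le (abs_mul_mul_le h₇ m n₂)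
  have e₈ := neg_le_of_abs_le (abs_mul_mul_le h₈ y' z)
  have e₉ := neg_le_of_abs_le (abs_mul_mul_le h₉ v y)
  have f₁ := neg_le_of_abs_le (abs_mul_mul_le k₁ y y)
  have f₂ := neg_le_of_abs_le (abs_mul_mul_le k₂ z z)
  have f₃ := neg_le_of_abs_le (abs_mul_mul_le_eighth k₃ a z)
  have f₄ := neg_le_of_abs_le (abs_mul_mul_le_eighth k₄ a y)
  rw [hy] at e₈
  have g₁ := mul_le_mul_of_nonneg_left hm hK
  have g₂ := mul_le_mul_of_nonneg_left hm (sq_nonneg K)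
  have g₃ := mul_le_mul_of_nonneg_left hm (mul_nonneg hM.le hK)
  have p₁ := mul_nonneg hK (sq_nonneg y)
  have p₂ := mul_nonneg hK (sq_nonneg z)
  have p₃ := mul_nonneg hK (sq_nonneg n₁)
  have p₄ := mul_nonneg hK (sq_nonneg n₂)
  have p₅ := mul_nonneg hK (sq_nonneg v)
  have q₁ := mul_nonneg (sq_nonneg K) (sq_nonneg y)
  have q₂ := mul_nonneg (sq_nonneg K) (sq_nonneg z)
  have q₃ := mul_nonneg (sq_nonneg K) (sq_nonneg n₁)
  have q₄ := mul_nonneg (sq_nonneg K) (sq_nonneg n₂)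
  have q₅ := mul_nonneg (sq_nonneg K) (sq_nonneg v)
  have r₁ := mul_nonneg (mul_nonneg hM.le hK) (sq_nonneg y)
  have r₂ := mul_nonneg (mul_nonneg hM.le hK) (sq_nonneg z)
  have r₃ := mul_nonneg (mul_nonneg hM.le hK) (sq_nonneg v)
  have s := sq_nonneg a
  nlinarith only [e₁, e₂, e₃, e₄, e₅, e₆, e₇, e₈, e₉, f₁, f₂, f₃, f₄, g₁, g₂, g₃, p₁, p₂, p₃, p₄,
    p₅, q₁, q₂, q₃, q₄, q₅, r₁, r₂, r₃, s]

/-- The multiplier identity for the wave equation, in rescaled variables. -/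
lemma wave_multiplier_rescaled {M ε w q p L σ α κ α₁ b₁ Bt Br βt βr a m z n₁ n₂ v : ℝ}
    (hw : w ≠ 0) (hq : q ≠ 0) (hp : p ≠ 0) (hm : m = α * n₁ + n₂)
    {r Φ Φt Φr ut ur u : ℝ} (hr : r = w^2) (hΦ : Φ = w^4 * q * m) (hΦt : Φt = w * q * z)
    (hΦr : Φr = a * w / q) (hut : ut = w^2 * n₁) (hur : ur = w^2 * n₂) (hu : u = w^3 * v) :
    q^2 * Φr^2 / r + L * Φ^2 / r^3
      - Φ / r * (ε * (Bt * ut + βt * Φt + Br * ur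
          + βr * (Φr - b₁ * (α * ut + ur) - r * q * α₁ * ut))
        + 2 * q * (ε * (βt * ut + βr * ur)) - 2 / (r * q^2 * p) * Φt
        - M / (r^2 * q) * ((2 - 3 * M / r) * ur + κ * ut) + σ * (2 * M * q / r^3) * u)
      + 2 * M * Φ * Φt / r^3 + σ * (2 * M) * Φ^2 / r^4 - 1 / r * (1 + 2 * M / r) * Φt^2
      + 4 * M / r^2 * Φr * Φt - q^2 * Φr * Φ / r^2
    = L * Φ^2 / r^3 + (a^2
      + (-(ε * (w^3 * Bt))) * (w * q * m) * n₁ + (-(ε * (w^3 * Br))) * (w * q * m) * n₂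
      + (-(ε * (w^4 * βt)) * q / w^2 + 2 * M / w^2 * q) * (w * q * m) * z
      + (-(ε * (w^4 * βr)) / w) * a * m
      + (ε * (w^4 * βr) * (q * b₁)) * m * m
      + (ε * (w^4 * βr) * (q^2 * (w^2 * α₁)) - 2 * q^2 * (ε * (w^4 * βt)) + M * κ) * m * n₁
      + (-(2 * q^2 * (ε * (w^4 * βr))) + M * (2 - 3 * M / w^2)) * m * n₂
      + (2 / p) * (w * m) * z
      + (-(σ * (2 * M / w^2) * q)) * v * (w * q * m)
      + (σ * (2 * M / w^2)) * (w * q * m) * (w * q * m)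
      + (-((1 + 2 * M / w^2) * q^2)) * z * z
      + (4 * M / w^2) * a * z
      + (-q) * a * (w * q * m)) := by
  subst hr hΦ hΦt hΦr hut hur hu hm
  field_simp
  ring

end Absorb

/-! ### Coefficient bounds -/

section Coefficients

variable {M r : ℝ}

lemma qc_lt_one (hM : 0 < M) (hr : 2*M < r) : qc M r < 1 := by
  have h0 : 0 < r := by linarith
  have h1 := qc_sq hM hr
  have h2 : 0 < 2*M/r := by positivity
  nlinarith [qc_pos hM hr]

lemma mass_ratio_lt_one (hM : 0 < M) (hr : 2*M < r) : 2*M/r < 1 := by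
  rw [div_lt_one (by linarith)]
  exact hr

lemma alphac_nonneg (hM : 0 < M) (hr : 2*M < r) : 0 ≤ alphac M r := by
  have h := one_lt_pc hM hr
  rw [alphac]
  apply div_nonneg <;> nlinarith

lemma alphac_le (hM : 0 < M) (hr : 2*M < r) : alphac M r ≤ 3 := by
  have h := one_lt_pc hM hr
  have h2 := pc_lt_two hM hr
  rw [alphac, div_le_iff₀ (by linarith)]
  nlinarith

lemma abs_alphac1_le (hM : 0 < M) (hr : 2*M < r) : r * |alphac1 M r| ≤ 9/4 := by
  have h0 : 0 < r := by linarith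
  have h := one_lt_pc hM hr
  have h1 : 3 / (2 * (2 + pc M r)^2) ≤ 3/2 := by
    rw [div_le_div_iff₀ (by positivity) (by norm_num)]
    nlinarith
  have h2 : 0 ≤ 3 / (2 * (2 + pc M r)^2) := by positivity
  have h3 : |(-3 * M / (r^2 * pc M r))| = 3 * M / (r^2 * pc M r) := by
    rw [neg_mul, neg_div, abs_neg, abs_of_nonneg (by positivity)]
  have h4 : r * (3 * M / (r^2 * pc M r)) ≤ 3/2 := by
    have e : r * (3 * M / (r^2 * pc M r)) = 3 * M / (r * pc M r) := by field_simp
    rw [e, div_le_div_iff₀ (by positivity) (by norm_num)]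
    nlinarith
  rw [alphac1, abs_mul, h3, abs_of_nonneg (by linarith)]
  have h5 : 0 ≤ r * (3 * M / (r^2 * pc M r)) := by positivity
  calc r * ((3/2 - 3 / (2 * (2 + pc M r)^2)) * (3 * M / (r^2 * pc M r)))
      = (3/2 - 3 / (2 * (2 + pc M r)^2)) * (r * (3 * M / (r^2 * pc M r))) := by ring
    _ ≤ 3/2 * (3/2) := mul_le_mul (by linarith) h4 h5 (by norm_num)
    _ = 9/4 := by norm_num

lemma abs_kappac_le (hM : 0 < M) (hr : 2*M < r) : |kappac M r| ≤ 40 := by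
  have h := one_lt_pc hM hr
  have h2 := pc_lt_two hM hr
  rw [kappac]
  generalize pc M r = p at *
  have k (n : ℕ) : 1 ≤ p^n ∧ p^n ≤ 2^n :=
    ⟨one_le_pow₀ h.le, pow_le_pow_left₀ (by linarith) h2.le n⟩
  have k2 := k 2
  have k3 := k 3
  have k4 := k 4
  have k5 := k 5
  have k6 := k 6
  norm_num at k2 k3 k4 k5 k6
  have k1 := sq_nonneg p
  have hd : 6 ≤ 2 * p^3 * (2 + p) := by nlinarith
  rw [abs_div, abs_of_pos (show 0 < 2 * p^3 * (2 + p) by linarith),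
    div_le_iff₀ (by linarith)]
  calc _ ≤ (240 : ℝ) := abs_le.2 ⟨by linarith, by linarith⟩
    _ ≤ _ := by linarith

lemma qc_mul_bc1 (hM : 0 < M) (hr : 2*M < r) : qc M r * bc1 M r = 1 - M/r := by
  have h0 : r ≠ 0 := by linarith
  have hq := (qc_pos hM hr).ne'
  rw [bc1, mul_add, ← sq, qc_sq hM hr]
  field_simp
  ring

end Coefficients

/-! ### The pointwise bulk estimate -/

section Bulk

variable {M r : ℝ}

lemma abs_mul_le_of_le {x y X Y : ℝ} (hx : |x| ≤ X) (hy : |y| ≤ Y) : |x * y| ≤ X * Y := by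
  rw [abs_mul]
  exact mul_le_mul hx hy (abs_nonneg _) ((abs_nonneg _).trans hx)

lemma sq_mul_add_le {α : ℝ} (h0 : 0 ≤ α) (h : α ≤ 3) (x y : ℝ) :
    (α * x + y)^2 ≤ 10 * (x^2 + y^2) := by
  have h1 : α^2 ≤ 3^2 := pow_le_pow_left₀ h0 h 2
  have h2 := mul_le_mul_of_nonneg_right h1 (add_nonneg (sq_nonneg x) (sq_nonneg y))
  linear_combination h2 + sq_nonneg (x - α * y)

/-- Bounds on the coefficients in `wave_multiplier_rescaled`. -/
lemma rescaled_coefficient_bounds {C K ε σ Bt Br βt βr w q p α₁ b₁ κ : ℝ}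
    (hM : 0 < M) (hr : 2*M < r) (hε0 : 0 ≤ ε) (hε1 : ε ≤ 1) (hσ : |σ| ≤ 3)
    (hβ : r^2 * |βt| + r^2 * |βr| + w^3 * |Bt| + w^3 * |Br| ≤ C)
    (hK : K = 10 + 5 * C + 40 * M + C / (2*M) + C / √(2*M)) (hw : 0 < w) (hwr : r = w^2)
    (hwM : √(2*M) ≤ w) (hq : 0 < q) (hq1 : q < 1) (hp : 1 < p) (hα1 : r * |α₁| ≤ 9/4)
    (hκ : |κ| ≤ 40) (hqb : q * b₁ = 1 - M/r) :
    (|(-(ε * (w^3 * Bt)))| ≤ K ∧ |(-(ε * (w^3 * Br)))| ≤ K ∧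
      |(-(ε * (w^4 * βt)) * q / w^2 + 2 * M / w^2 * q)| ≤ K ∧ |(-(ε * (w^4 * βr)) / w)| ≤ K) ∧
    (|ε * (w^4 * βr) * (q * b₁)| ≤ K ∧
      |ε * (w^4 * βr) * (q^2 * (w^2 * α₁)) - 2 * q^2 * (ε * (w^4 * βt)) + M * κ| ≤ K ∧
      |(-(2 * q^2 * (ε * (w^4 * βr))) + M * (2 - 3 * M / w^2))| ≤ K ∧ |2 / p| ≤ K) ∧
    |(-(σ * (2 * M / w^2) * q))| ≤ K ∧ |σ * (2 * M / w^2)| ≤ K ∧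
      |(-((1 + 2 * M / w^2) * q^2))| ≤ K ∧ |4 * M / w^2| ≤ K ∧ |(-q)| ≤ K := by
  have hr0 : 0 < r := by linarith
  have hM1 := mass_ratio_lt_one hM hr
  have hM2 : 0 < 2*M/r := by positivity
  have hwM0 : 0 < √(2*M) := Real.sqrt_pos.2 (by linarith)
  have hC : 0 ≤ C := le_trans (by positivity) hβ
  have B1 : |ε * (w^3 * Bt)| ≤ C := by
    rw [abs_mul, abs_mul, abs_of_nonneg hε0, abs_of_pos (pow_pos hw 3)]
    have h1 : 0 ≤ w^3 * |Bt| := by positivity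
    have h2 : w^3 * |Bt| ≤ C := le_trans (by
      have : 0 ≤ r^2 * |βt| + r^2 * |βr| + w^3 * |Br| := by positivity
      linarith) hβ
    nlinarith
  have B2 : |ε * (w^3 * Br)| ≤ C := by
    rw [abs_mul, abs_mul, abs_of_nonneg hε0, abs_of_pos (pow_pos hw 3)]
    have h1 : 0 ≤ w^3 * |Br| := by positivity
    have h2 : w^3 * |Br| ≤ C := le_trans (by
      have : 0 ≤ r^2 * |βt| + r^2 * |βr| + w^3 * |Bt| := by positivity
      linarith) hβ
    nlinarith
  have hw4 : w^4 = r^2 := by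
    rw [hwr]
    ring
  have B3 : |ε * (w^4 * βt)| ≤ C := by
    rw [hw4, abs_mul, abs_mul, abs_of_nonneg hε0, abs_of_pos (pow_pos hr0 2)]
    have h1 : 0 ≤ r^2 * |βt| := by positivity
    have h2 : r^2 * |βt| ≤ C := le_trans (by
      have : 0 ≤ w^3 * |Br| + r^2 * |βr| + w^3 * |Bt| := by positivity
      linarith) hβ
    nlinarith
  have B4 : |ε * (w^4 * βr)| ≤ C := by
    rw [hw4, abs_mul, abs_mul, abs_of_nonneg hε0, abs_of_pos (pow_pos hr0 2)]
    have h1 : 0 ≤ r^2 * |βr| := by positivity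
    have h2 : r^2 * |βr| ≤ C := le_trans (by
      have : 0 ≤ w^3 * |Br| + r^2 * |βt| + w^3 * |Bt| := by positivity
      linarith) hβ
    nlinarith
  have hC1 : 0 ≤ C / (2*M) := by positivity
  have hC2 : 0 ≤ C / √(2*M) := by positivity
  have Q1 : |q| ≤ 1 := by
    rw [abs_of_pos hq]
    exact hq1.le
  have Q2 : |q^2| ≤ 1 := by
    rw [abs_of_nonneg (sq_nonneg q)]
    nlinarith
  have R1 : |2 * M / w^2| ≤ 1 := by
    rw [← hwr, abs_of_pos hM2]
    exact hM1.le
  have hwα : |w^2 * α₁| ≤ 9/4 := by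
    rw [← hwr, abs_mul, abs_of_pos hr0]
    exact hα1
  have hMr : M / r = (2*M/r) / 2 := by ring
  have b1 : |(-(ε * (w^3 * Bt)))| ≤ K := by
    rw [abs_neg]
    linarith
  have b2 : |(-(ε * (w^3 * Br)))| ≤ K := by
    rw [abs_neg]
    linarith
  have b3 : |(-(ε * (w^4 * βt)) * q / w^2 + 2 * M / w^2 * q)| ≤ K := by
    have h1 : |(-(ε * (w^4 * βt)) * q / w^2)| ≤ C / (2*M) := by
      rw [abs_div, ← hwr, abs_of_pos hr0]
      refine div_le_div₀ hC ?_ (by linarith) hr.le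
      rw [neg_mul, abs_neg]
      simpa using abs_mul_le_of_le B3 Q1
    have h2 := abs_mul_le_of_le R1 Q1
    have h3 := abs_add_le (-(ε * (w^4 * βt)) * q / w^2) (2 * M / w^2 * q)
    linarith
  have b4 : |(-(ε * (w^4 * βr)) / w)| ≤ K := by
    have h1 : |(-(ε * (w^4 * βr)) / w)| ≤ C / √(2*M) := by
      rw [abs_div, abs_of_pos hw, abs_neg]
      exact div_le_div₀ hC B4 hwM0 hwM
    linarith
  have b5 : |ε * (w^4 * βr) * (q * b₁)| ≤ K := by
    have h1 : |q * b₁| ≤ 1 := by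
      rw [hqb, abs_le]
      constructor <;> linarith
    have h2 := abs_mul_le_of_le B4 h1
    linarith
  have b6 : |ε * (w^4 * βr) * (q^2 * (w^2 * α₁)) - 2 * q^2 * (ε * (w^4 * βt)) + M * κ| ≤ K := by
    have h1 := abs_mul_le_of_le B4 (abs_mul_le_of_le Q2 hwα)
    have h2 := abs_mul_le_of_le Q2 B3
    have h3 : |M * κ| ≤ M * 40 := abs_mul_le_of_le (abs_of_pos hM).le hκ
    rw [abs_le] at h1 h2 h3 ⊢
    constructor <;> linarith
  have b7 : |(-(2 * q^2 * (ε * (w^4 * βr))) + M * (2 - 3 * M / w^2))| ≤ K := by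
    have h2 := abs_mul_le_of_le Q2 B4
    have h4 : |2 - 3 * M / w^2| ≤ 2 := by
      have : 3 * M / r = 3/2 * (2*M/r) := by ring
      rw [← hwr, this, abs_le]
      constructor <;> linarith
    have h3 : |M * (2 - 3 * M / w^2)| ≤ M * 2 := abs_mul_le_of_le (abs_of_pos hM).le h4
    rw [abs_le] at h2 h3 ⊢
    constructor <;> linarith
  have b8 : |2 / p| ≤ K := by
    have : |2 / p| ≤ 2 := by
      rw [abs_of_pos (by positivity), div_le_iff₀ (by linarith)]
      linarith
    linarith
  have S1 := abs_mul_le_of_le hσ R1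
  have b9 : |(-(σ * (2 * M / w^2) * q))| ≤ K := by
    have := abs_mul_le_of_le S1 Q1
    rw [abs_neg]
    linarith
  have c1 : |σ * (2 * M / w^2)| ≤ K := by linarith
  have c2 : |(-((1 + 2 * M / w^2) * q^2))| ≤ K := by
    have h1 := abs_mul_le_of_le R1 Q2
    have h2 : (1 + 2 * M / w^2) * q^2 = q^2 + 2 * M / w^2 * q^2 := by ring
    have h3 := abs_add_le (q^2) (2 * M / w^2 * q^2)
    rw [abs_neg, h2]
    linarith
  have c3 : |4 * M / w^2| ≤ K := by
    have h1 : 4 * M / w^2 = 2 * (2 * M / w^2) := by ring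
    rw [h1, abs_mul, abs_two]
    linarith
  have c4 : |(-q)| ≤ K := by
    rw [abs_neg]
    linarith
  exact ⟨⟨b1, b2, b3, b4⟩, ⟨b5, b6, b7, b8⟩, b9, c1, c2, c3, c4⟩

lemma neg_div_lagrangian_lower_bound {C ε L σ Bt Br βt βr Φ Φt Φr ut ur u : ℝ}
    (hM : 0 < M) (hr : 2*M < r) (hε0 : 0 ≤ ε) (hε1 : ε ≤ 1) (hσ : |σ| ≤ 3)
    (hβ : r^2 * |βt| + r^2 * |βr| + r ^ ((3:ℝ)/2) * |Bt| + r ^ ((3:ℝ)/2) * |Br| ≤ C)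
    (hΦ : Φ = r * qc M r * (alphac M r * ut + ur))
    {K : ℝ} (hK : K = 10 + 5 * C + 40 * M + C / (2*M) + C / √(2*M)) :
    qc M r^2 * Φr^2 / r / 2 + L * Φ^2 / r^3 - (50 * K + 20 * M * K + 20 * K^2) *
        (Φ^2 / r^3 + Φt^2 / (r * qc M r^2) + (ut^2 / r^2 + ur^2 / r^2) + u^2 / r^3) ≤
      qc M r^2 * Φr^2 / r + L * Φ^2 / r^3
      - Φ / r * (ε * (Bt * ut + βt * Φt + Br * ur
          + βr * (Φr - bc1 M r * (alphac M r * ut + ur) - r * qc M r * alphac1 M r * ut))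
        + 2 * qc M r * (ε * (βt * ut + βr * ur)) - 2 / (r * qc M r^2 * pc M r) * Φt
        - M / (r^2 * qc M r) * ((2 - 3 * M / r) * ur + kappac M r * ut)
        + σ * (2 * M * qc M r / r^3) * u)
      + 2 * M * Φ * Φt / r^3 + σ * (2 * M) * Φ^2 / r^4 - 1 / r * (1 + 2 * M / r) * Φt^2
      + 4 * M / r^2 * Φr * Φt - qc M r^2 * Φr * Φ / r^2 := by
  have hr0 : 0 < r := by linarith
  have hq := qc_pos hM hr
  have hq1 := qc_lt_one hM hr
  have hp := one_lt_pc hM hr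
  have hα0 := alphac_nonneg hM hr
  have hα := alphac_le hM hr
  have hα1 := abs_alphac1_le hM hr
  have hκ := abs_kappac_le hM hr
  have hqb := qc_mul_bc1 hM hr
  have hqs := qc_sq hM hr
  have hw : 0 < √r := Real.sqrt_pos.2 hr0
  have hwr : r = √r ^ 2 := (Real.sq_sqrt hr0.le).symm
  have hw3 : r ^ ((3:ℝ)/2) = √r ^ 3 := by
    rw [Real.sqrt_eq_rpow, ← Real.rpow_natCast, ← Real.rpow_mul hr0.le]
    norm_num
  have hwM : √(2*M) ≤ √r := Real.sqrt_le_sqrt hr.le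
  rw [hw3] at hβ
  generalize qc M r = q at *
  generalize pc M r = p at *
  generalize alphac M r = α at *
  generalize alphac1 M r = α₁ at *
  generalize kappac M r = κ at *
  generalize bc1 M r = b₁ at *
  set w := √r
  have key := wave_multiplier_rescaled (M := M) (ε := ε) (L := L) (σ := σ) (κ := κ) (α₁ := α₁)
    (b₁ := b₁) (Bt := Bt) (Br := Br) (βt := βt) (βr := βr) (α := α)
    (m := α * (ut / w^2) + ur / w^2) (a := Φr * q / w) (z := Φt / (w * q)) (n₁ := ut / w^2)
    (n₂ := ur / w^2) (v := u / w^3) (p := p) (r := r) (Φ := Φ) (Φt := Φt) (Φr := Φr) (ut := ut)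
    (ur := ur) (u := u) hw.ne' hq.ne' (by linarith) rfl hwr
    (by rw [hΦ, hwr]; field_simp) (by field_simp) (by field_simp) (by field_simp)
    (by field_simp) (by field_simp)
  rw [key]
  clear key
  set m := α * (ut / w^2) + ur / w^2 with hm
  obtain ⟨⟨b1, b2, b3, b4⟩, ⟨b5, b6, b7, b8⟩, b9, c1, c2, c3, c4⟩ :=
    rescaled_coefficient_bounds hM hr hε0 hε1 hσ hβ hK hw hwr hwM hq hq1 hp hα1 hκ hqb
  have hm2 : m^2 ≤ 10 * ((ut / w^2)^2 + (ur / w^2)^2) :=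
    sq_mul_add_le hα0 hα _ _
  have hy : (w * m)^2 = (w * q * m)^2 + 2 * M * m^2 := by
    have : w^2 * q^2 = w^2 - 2*M := by
      rw [hqs, ← hwr]
      field_simp
    linear_combination m^2 * (-this)
  have := quadratic_form_lower_bound (a := Φr * q / w) (y := w * q * m) (y' := w * m)
    (z := Φt / (w * q)) (n₁ := ut / w^2) (n₂ := ur / w^2) (m := m) (v := u / w^3)
    hM hm2 hy b1 b2 b3 b4 b5 b6 b7 b8 b9 c1 c2 c3 c4
  clear b1 b2 b3 b4 b5 b6 b7 b8 b9 c1 c2 c3 c4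
  have e1 : Φ^2 / r^3 = (w * q * m)^2 := by
    rw [hm, hΦ, hwr]
    field_simp
  have e2 : Φt^2 / (r * q^2) = (Φt / (w * q))^2 := by
    rw [hwr, div_pow, mul_pow]
  have e3 : ut^2 / r^2 = (ut / w^2)^2 := by rw [hwr, div_pow]
  have e4 : ur^2 / r^2 = (ur / w^2)^2 := by rw [hwr, div_pow]
  have e5 : u^2 / r^3 = (u / w^3)^2 := by
    rw [hwr, div_pow]
    ring
  have e6 : q^2 * Φr^2 / r = (Φr * q / w)^2 := by
    rw [hwr, div_pow]
    ring
  refine le_trans (le_of_eq ?_) (add_le_add_right this _)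
  rw [← e1, e6, e2, e3, e4, e5]
  ring

lemma div_product_current_lower_bound {δ Φ Φt Φr ut ur u : ℝ}
    (hM : 0 < M) (hr : 2*M < r) (hδ : 0 < δ) (hΦ : Φ = r * qc M r * (alphac M r * ut + ur)) :
    Φ^2 / r^3 / 2 - δ * (qc M r^2 * Φr^2 / r) - (5 + 11 * (1 + M) + 1 / (4 * δ)) *
        (Φt^2 / (r * qc M r^2) + (ut^2 / r^2 + ur^2 / r^2) + u^2 / r^3) ≤
      Φ^2 / r^3 + qc M r * alphac M r / r^2 * Φt * u + qc M r / r^2 * Φr * u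
        + (-(2 * qc M r / r^3) + M / (r^4 * qc M r)) * Φ * u := by
  have hr0 : 0 < r := by linarith
  have hq := qc_pos hM hr
  have hq1 := qc_lt_one hM hr
  have hα0 := alphac_nonneg hM hr
  have hα := alphac_le hM hr
  have hw : 0 < √r := Real.sqrt_pos.2 hr0
  have hwr : r = √r ^ 2 := (Real.sq_sqrt hr0.le).symm
  generalize qc M r = q at *
  generalize alphac M r = α at *
  set w := √r
  set m := α * (ut / w^2) + ur / w^2 with hm
  have e1 : Φ^2 / r^3 = (w * q * m)^2 := by
    rw [hm, hΦ, hwr]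
    field_simp
  have e2 : Φt^2 / (r * q^2) = (Φt / (w * q))^2 := by
    rw [hwr, div_pow, mul_pow]
  have e3 : ut^2 / r^2 = (ut / w^2)^2 := by rw [hwr, div_pow]
  have e4 : ur^2 / r^2 = (ur / w^2)^2 := by rw [hwr, div_pow]
  have e5 : u^2 / r^3 = (u / w^3)^2 := by
    rw [hwr, div_pow]
    ring
  have e6 : q^2 * Φr^2 / r = (Φr * q / w)^2 := by
    rw [hwr, div_pow]
    ring
  have e7 : q * α / r^2 * Φt * u = (q^2 * α) * (Φt / (w * q)) * (u / w^3) := by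
    rw [hwr]
    field_simp
  have e8 : q / r^2 * Φr * u = 1 * (u / w^3) * (Φr * q / w) := by
    rw [hwr]
    field_simp
  have e9 : (-(2 * q / r^3) + M / (r^4 * q)) * Φ * u
      = -(2 * q * (u / w^3) * (w * q * m)) + M / w * m * (u / w^3) := by
    rw [hm, hΦ, hwr]
    field_simp
  have hm2 : m^2 ≤ 10 * ((ut / w^2)^2 + (ur / w^2)^2) :=
    sq_mul_add_le hα0 hα _ _
  have hMw : |M / w| ≤ 1 + M := by
    rw [abs_of_pos (by positivity), div_le_iff₀ hw]
    have h1 : M < w^2 := by linarith only [hr, hwr, hM]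
    nlinarith only [h1, hw, hM]
  have hqα : |q^2 * α| ≤ 3 := by
    rw [abs_of_nonneg (by positivity)]
    have h1 : q^2 ≤ 1 := pow_le_one₀ hq.le hq1.le
    calc q^2 * α ≤ 1 * 3 := mul_le_mul h1 hα hα0 zero_le_one
      _ = 3 := by norm_num
  have h2q : |2 * q| ≤ 2 := by
    rw [abs_of_pos (by positivity)]
    linarith
  have f1 := neg_le_of_abs_le (abs_mul_mul_le hqα (Φt / (w * q)) (u / w^3))
  have f2 := neg_le_of_abs_le (abs_mul_mul_le_small (abs_one (α := ℝ)).le hδ (Φr * q / w) (u / w^3))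
  rw [one_pow] at f2
  have f3 := le_of_abs_le (abs_mul_mul_le_small h2q (by norm_num : (0:ℝ) < 1/2)
    (w * q * m) (u / w^3))
  have f4 := neg_le_of_abs_le (abs_mul_mul_le hMw m (u / w^3))
  have f5 := mul_le_mul_of_nonneg_left hm2 (by linarith : 0 ≤ 1 + M)
  norm_num at f3
  have hδ' : 0 ≤ 1 / (4 * δ) := by positivity
  have f6 := mul_nonneg hδ' (sq_nonneg (Φt / (w * q)))
  have f7 := mul_nonneg hδ' (sq_nonneg (ut / w^2))
  have f8 := mul_nonneg hδ' (sq_nonneg (ur / w^2))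
  have g6 := mul_nonneg hM.le (sq_nonneg (Φt / (w * q)))
  have g7 := mul_nonneg hM.le (sq_nonneg (ut / w^2))
  have g8 := mul_nonneg hM.le (sq_nonneg (ur / w^2))
  have g9 := mul_nonneg hM.le (sq_nonneg (u / w^3))
  rw [e6, e2, e3, e4, e5, e1, e7, e8, e9]
  generalize 1 / (4 * δ) = δ' at *
  nlinarith only [f1, f2, f3, f4, f5, f6, f7, f8, g6, g7, g8, g9, sq_nonneg (Φt / (w * q)), sq_nonneg (ut / w^2),
    sq_nonneg (ur / w^2), sq_nonneg (u / w^3)]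

end Bulk

/-! ### The currents and their divergence -/

section Currents

variable {M r : ℝ} {u v : ℝ → ℝ → ℝ}

/-- Time component of the Lagrangian current with multiplier `1/r`. -/
def lagrangianCt (M : ℝ) (u : ℝ → ℝ → ℝ) (t r : ℝ) : ℝ :=
  (1/r + 2*M/r^2) * (pt u t r * u t r) - 4*M/r^2 * (pr u t r * u t r)

/-- Radial component of the Lagrangian current with multiplier `1/r`. -/
def lagrangianCr (M : ℝ) (u : ℝ → ℝ → ℝ) (t r : ℝ) : ℝ :=
  -(Dc M r * r⁻¹) * (pr u t r * u t r)

/-- Time component of the current whose divergence contains `(W u)² / r³`. -/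
def productCt (M : ℝ) (u : ℝ → ℝ → ℝ) (t r : ℝ) : ℝ :=
  qc M r * alphac M r / r^2 * (Wc M u t r * u t r)

/-- Radial component of the current whose divergence contains `(W u)² / r³`. -/
def productCr (M : ℝ) (u : ℝ → ℝ → ℝ) (t r : ℝ) : ℝ :=
  qc M r / r^2 * (Wc M u t r * u t r)

/-- Time component of the combined current. -/
def currentCt (M l m : ℝ) (u : ℝ → ℝ → ℝ) (t r : ℝ) : ℝ :=
  m * (l * productCt M u t r - lagrangianCt M (Wc M u) t r)

/-- Radial component of the combined current. -/
def currentCr (M l m : ℝ) (u : ℝ → ℝ → ℝ) (t r : ℝ) : ℝ :=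
  m * (l * productCr M u t r - lagrangianCr M (Wc M u) t r)

lemma contDiffOn_const_div_pow (hM : 0 < M) (c : ℝ) (n : ℕ) :
    ContDiffOn ℝ ∞ (fun r : ℝ => c / r^n) (Ioi (2*M)) :=
  (contDiffOn_const.mul ((contDiffOn_inv_r hM).pow n)).congr fun r _ => by
    rw [inv_pow, div_eq_mul_inv]

lemma smoothOnRegion_lagrangianCt (hM : 0 < M) (hu : SmoothOnRegion u (Ioi (2*M))) :
    SmoothOnRegion (lagrangianCt M u) (Ioi (2*M)) := by
  have h1 : ContDiffOn ℝ ∞ (fun r : ℝ => 1/r + 2*M/r^2) (Ioi (2*M)) := by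
    simpa using (contDiffOn_const_div_pow hM 1 1).add (contDiffOn_const_div_pow hM (2*M) 2)
  exact ((SmoothOnRegion.radial h1).mul (hu.pt.mul hu)).sub
    ((SmoothOnRegion.radial (contDiffOn_const_div_pow hM (4*M) 2)).mul (hu.pr.mul hu))

lemma smoothOnRegion_lagrangianCr (hM : 0 < M) (hu : SmoothOnRegion u (Ioi (2*M))) :
    SmoothOnRegion (lagrangianCr M u) (Ioi (2*M)) :=
  (SmoothOnRegion.radial ((contDiffOn_Dc hM).mul (contDiffOn_inv_r hM)).neg).mul (hu.pr.mul hu)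

lemma smoothOnRegion_productCt (hM : 0 < M) (hu : SmoothOnRegion u (Ioi (2*M))) :
    SmoothOnRegion (productCt M u) (Ioi (2*M)) := by
  have h : ContDiffOn ℝ ∞ (fun r => qc M r * alphac M r / r^2) (Ioi (2*M)) :=
    (((contDiffOn_qc hM).mul (contDiffOn_alphac hM)).mul
      (contDiffOn_const_div_pow hM 1 2)).congr fun r _ => by ring
  exact (SmoothOnRegion.radial h).mul ((hu.Wc hM).mul hu)

lemma smoothOnRegion_productCr (hM : 0 < M) (hu : SmoothOnRegion u (Ioi (2*M))) :
    SmoothOnRegion (productCr M u) (Ioi (2*M)) := by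
  have h : ContDiffOn ℝ ∞ (fun r => qc M r / r^2) (Ioi (2*M)) :=
    ((contDiffOn_qc hM).mul (contDiffOn_const_div_pow hM 1 2)).congr fun r _ => by ring
  exact (SmoothOnRegion.radial h).mul ((hu.Wc hM).mul hu)

lemma smoothOnRegion_currentCt (hM : 0 < M) (hu : SmoothOnRegion u (Ioi (2*M))) (l m : ℝ) :
    SmoothOnRegion (currentCt M l m u) (Ioi (2*M)) :=
  (SmoothOnRegion.const m).mul (((SmoothOnRegion.const l).mul (smoothOnRegion_productCt hM hu)).sub
    (smoothOnRegion_lagrangianCt hM (hu.Wc hM)))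

lemma smoothOnRegion_currentCr (hM : 0 < M) (hu : SmoothOnRegion u (Ioi (2*M))) (l m : ℝ) :
    SmoothOnRegion (currentCr M l m u) (Ioi (2*M)) :=
  (SmoothOnRegion.const m).mul (((SmoothOnRegion.const l).mul (smoothOnRegion_productCr hM hu)).sub
    (smoothOnRegion_lagrangianCr hM (hu.Wc hM)))

lemma pt_currentCt (hM : 0 < M) (hu : SmoothOnRegion u (Ioi (2*M))) (hr : 2*M < r) (l m t : ℝ) :
    pt (currentCt M l m u) t r =
      m * (l * pt (productCt M u) t r - pt (lagrangianCt M (Wc M u)) t r) :=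
  ((((smoothOnRegion_productCt hM hu).hasDerivAt_pt hr).const_mul l).sub
    ((smoothOnRegion_lagrangianCt hM (hu.Wc hM)).hasDerivAt_pt hr)).const_mul m |>.deriv

lemma pr_currentCr (hM : 0 < M) (hu : SmoothOnRegion u (Ioi (2*M))) (hr : 2*M < r) (l m t : ℝ) :
    pr (currentCr M l m u) t r =
      m * (l * pr (productCr M u) t r - pr (lagrangianCr M (Wc M u)) t r) :=
  ((((smoothOnRegion_productCr hM hu).hasDerivAt_pr hr).const_mul l).sub
    ((smoothOnRegion_lagrangianCr hM (hu.Wc hM)).hasDerivAt_pr hr)).const_mul m |>.deriv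

lemma div_lagrangian (s ℓ : ℕ) (hM : 0 < M) (hu : SmoothOnRegion u (Ioi (2*M))) (hr : 2*M < r)
    (t : ℝ) :
    -(pt (lagrangianCt M u) t r + pr (lagrangianCr M u) t r) =
      qc M r^2 * pr u t r^2 / r + (ℓ : ℝ)*((ℓ : ℝ)+1) * u t r^2 / r^3
      - u t r / r * Pc M s ℓ u t r
      + 2 * M * u t r * pt u t r / r^3 + (1 - (s:ℝ)^2) * (2 * M) * u t r^2 / r^4
      - 1 / r * (1 + 2 * M / r) * pt u t r^2
      + 4 * M / r^2 * pr u t r * pt u t r - qc M r^2 * pr u t r * u t r / r^2 := by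
  have hr0 : r ≠ 0 := by linarith
  have ht := hu.hasDerivAt_pt hr (t := t)
  have h1 : pt (lagrangianCt M u) t r = _ :=
    (((hu.pt.hasDerivAt_pt hr).mul ht).const_mul (1/r + 2*M/r^2)).sub
      (((hu.pr.hasDerivAt_pt hr).mul ht).const_mul (4*M/r^2)) |>.deriv
  have h2 : pr (lagrangianCr M u) t r = _ :=
    ((((hasDerivAt_Dc hr0).mul (hasDerivAt_inv hr0)).neg).mul
      ((hu.pr.hasDerivAt_pr hr).mul (hu.hasDerivAt_pr hr))).deriv
  have hD : qc M r^2 = Dc M r := qc_sq hM hr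
  rw [h1, h2, Pc_eq s ℓ hM hu hr, hu.pt_pr hr, hD]
  simp only [Pi.neg_apply, Pi.mul_apply]
  field_simp
  ring

lemma div_product (hM : 0 < M) (hu : SmoothOnRegion u (Ioi (2*M))) (hr : 2*M < r) (t : ℝ) :
    pt (productCt M u) t r + pr (productCr M u) t r =
      Wc M u t r^2 / r^3 + qc M r * alphac M r / r^2 * pt (Wc M u) t r * u t r
        + qc M r / r^2 * pr (Wc M u) t r * u t r
        + (-(2 * qc M r / r^3) + M / (r^4 * qc M r)) * Wc M u t r * u t r := by
  have hr0 : r ≠ 0 := by linarith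
  have hq := (qc_pos hM hr).ne'
  have h1 : pt (productCt M u) t r = _ :=
    (((hu.Wc hM).hasDerivAt_pt hr (t := t)).mul (hu.hasDerivAt_pt hr)).const_mul
      (qc M r * alphac M r / r^2) |>.deriv
  have h2 : pr (productCr M u) t r = _ :=
    (((hasDerivAt_qc hM hr).div (hasDerivAt_pow 2 r) (pow_ne_zero 2 hr0)).mul
      (((hu.Wc hM).hasDerivAt_pr hr (t := t)).mul (hu.hasDerivAt_pr hr))).deriv
  have h3 : qc M r / r^2 * Wc M u t r * (alphac M r * pt u t r + pr u t r) = Wc M u t r^2 / r^3 := by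
    rw [Wc_eq hM hr]
    field_simp
  rw [h1, h2, ← h3]
  simp only [Pi.mul_apply, Pi.div_apply]
  field_simp
  ring

lemma Wc_congr (h : ∀ t r, 2*M < r → u t r = v t r) (hr : 2*M < r) (t : ℝ) :
    Wc M u t r = Wc M v t r := by
  simp only [Wc, Rst, pt_congr h hr, pr_congr h hr]

lemma Wc_mul (hM : 0 < M) (hu : SmoothOnRegion u (Ioi (2*M))) (hv : SmoothOnRegion v (Ioi (2*M)))
    (hr : 2*M < r) (t : ℝ) :
    Wc M (fun t r => u t r * v t r) t r = Wc M u t r * v t r + u t r * Wc M v t r := by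
  have h1 : pt (fun t r => u t r * v t r) t r = _ :=
    ((hu.hasDerivAt_pt hr).mul (hv.hasDerivAt_pt hr)).deriv
  have h2 : pr (fun t r => u t r * v t r) t r = _ :=
    ((hu.hasDerivAt_pr hr).mul (hv.hasDerivAt_pr hr)).deriv
  rw [Wc_eq hM hr, Wc_eq hM hr, Wc_eq hM hr, h1, h2]
  ring

lemma Wc_perturbation (hM : 0 < M) {ψ βt βr : ℝ → ℝ → ℝ} (ε : ℝ)
    (hψ : SmoothOnRegion ψ (Ioi (2*M)))
    (hβt : SmoothOnRegion βt (Ioi (2*M))) (hβr : SmoothOnRegion βr (Ioi (2*M)))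
    (hr : 2*M < r) (t : ℝ) :
    Wc M (fun t r => ε * (βt t r * pt ψ t r + βr t r * pr ψ t r)) t r =
      ε * (Wc M βt t r * pt ψ t r + βt t r * pt (Wc M ψ) t r + Wc M βr t r * pr ψ t r
        + βr t r * (pr (Wc M ψ) t r - bc1 M r * (alphac M r * pt ψ t r + pr ψ t r)
          - r * qc M r * alphac1 M r * pt ψ t r)) := by
  have h1 : pt (fun t r => ε * (βt t r * pt ψ t r + βr t r * pr ψ t r)) t r = _ :=
    (((hβt.mul hψ.pt).hasDerivAt_pt hr (t := t)).add
      ((hβr.mul hψ.pr).hasDerivAt_pt hr)).const_mul ε |>.deriv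
  have h2 : pr (fun t r => ε * (βt t r * pt ψ t r + βr t r * pr ψ t r)) t r = _ :=
    (((hβt.mul hψ.pt).hasDerivAt_pr hr (t := t)).add
      ((hβr.mul hψ.pr).hasDerivAt_pr hr)).const_mul ε |>.deriv
  have h3 := Wc_mul hM hβt hψ.pt hr t
  have h4 := Wc_mul hM hβr hψ.pr hr t
  rw [← pt_Wc hM hψ hr] at h3
  have h5 : Wc M (pr ψ) t r = pr (Wc M ψ) t r - bc1 M r * (alphac M r * pt ψ t r + pr ψ t r)
      - r * qc M r * alphac1 M r * pt ψ t r := by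
    rw [pr_Wc hM hψ hr, Wc_eq hM hr, hψ.pt_pr hr]
    ring
  rw [h5] at h4
  rw [Wc_eq hM hr] at h3 h4 ⊢
  rw [h1, h2]
  linear_combination ε * h3 + ε * h4

end Currents

/-! ### The pointwise estimate for solutions -/

section Pointwise

variable {M : ℝ}

lemma abs_one_sub_sq_le {s : ℕ} (hs : s ≤ 2) : |1 - (s:ℝ)^2| ≤ 3 := by
  interval_cases s <;> norm_num

lemma solution_div_lagrangian_lower_bound {C ε r : ℝ} {s ℓ : ℕ} {βt βr ψ : ℝ → ℝ → ℝ} (hM : 0 < M)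
    (hs : s ≤ 2) (hε0 : 0 ≤ ε) (hε1 : ε ≤ 1)
    (hβt : SmoothOnRegion βt (Ioi (2*M))) (hβr : SmoothOnRegion βr (Ioi (2*M)))
    (hβ : BetaBounds M C βt βr) (hψ : SmoothOnRegion ψ (Ioi (2*M)))
    (hsol : SolvesPerturbedRW M s ℓ ε βt βr ψ) (hr : 2*M < r) (t : ℝ)
    {K : ℝ} (hK : K = 10 + 5 * C + 40 * M + C / (2*M) + C / √(2*M)) :
    qc M r^2 * pr (Wc M ψ) t r^2 / r / 2 + (ℓ : ℝ)*((ℓ : ℝ)+1) * Wc M ψ t r^2 / r^3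
        - (50 * K + 20 * M * K + 20 * K^2) *
        (Wc M ψ t r^2 / r^3 + pt (Wc M ψ) t r^2 / (r * qc M r^2)
          + (pt ψ t r^2 / r^2 + pr ψ t r^2 / r^2) + ψ t r^2 / r^3) ≤
      -(pt (lagrangianCt M (Wc M ψ)) t r + pr (lagrangianCr M (Wc M ψ)) t r) := by
  rw [div_lagrangian s ℓ hM (hψ.Wc hM) hr, Pc_Wc s ℓ hM hψ hr, Wc_congr hsol hr,
    Wc_perturbation hM ε hψ hβt hβr hr, hsol t r hr]
  exact neg_div_lagrangian_lower_bound hM hr hε0 hε1 (abs_one_sub_sq_le hs) (hβ t r hr)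
    (Wc_eq hM hr ψ t) hK

/-- The pointwise form of the estimate: the bulk density is controlled by the right-hand side
density up to an exact divergence. -/
theorem exists_pointwise_estimate {C : ℝ} {s : ℕ} (hM : 0 < M) (hC : 0 < C) (hs : s ≤ 2) :
    ∃ l m A : ℝ, 0 ≤ l ∧ 0 ≤ m ∧ 0 ≤ A ∧ ∀ (ℓ : ℕ) (ε : ℝ), 0 ≤ ε → ε ≤ 1 →
      ∀ βt βr ψ : ℝ → ℝ → ℝ,
        SmoothOnRegion βt (Ioi (2*M)) → SmoothOnRegion βr (Ioi (2*M)) →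
        BetaBounds M C βt βr → SmoothOnRegion ψ (Ioi (2*M)) →
        SolvesPerturbedRW M s ℓ ε βt βr ψ → ∀ t r, 2*M < r →
        pt (Wc M ψ) t r^2 / r^2 + Dc M r * pr (Wc M ψ) t r^2 / r^2
            + (ℓ : ℝ)*((ℓ : ℝ)+1) * Wc M ψ t r^2 / r^3 + Wc M ψ t r^2 / r^3 ≤
          A * (pt (Wc M ψ) t r^2 / (r * Dc M r) + (pt ψ t r^2 / r^2 + pr ψ t r^2 / r^2
            + (ℓ : ℝ)*((ℓ : ℝ)+1) * ψ t r^2 / r^3 + ψ t r^2 / r^3))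
          + (pt (currentCt M l m ψ) t r + pr (currentCr M l m ψ) t r) := by
  obtain ⟨K, hK⟩ : ∃ K, K = 10 + 5 * C + 40 * M + C / (2*M) + C / √(2*M) := ⟨_, rfl⟩
  have hK0 : 0 < K := by
    rw [hK]
    positivity
  obtain ⟨B, hB⟩ : ∃ B, B = 50 * K + 20 * M * K + 20 * K^2 := ⟨_, rfl⟩
  have hB0 : 0 < B := by
    rw [hB]
    positivity
  obtain ⟨l, hl⟩ : ∃ l, l = 2 * (B + 1) := ⟨_, rfl⟩
  have hl0 : 0 < l := by
    rw [hl]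
    positivity
  obtain ⟨G, hG⟩ : ∃ G, G = 5 + 11 * (1 + M) + 1 / (4 * (1 / (4 * l))) := ⟨_, rfl⟩
  have hG0 : 0 < G := by
    rw [hG]
    positivity
  obtain ⟨m, hm⟩ : ∃ m, m = 1 + 2 / M := ⟨_, rfl⟩
  have hm0 : 0 < 2 / M := by positivity
  have hm1 : 1 ≤ m := by linarith
  refine ⟨l, m, 1 / (2*M) + m * (B + l * G), hl0.le, by linarith, by positivity, ?_⟩
  intro ℓ ε hε0 hε1 βt βr ψ hβt hβr hβ hψ hsol t r hr
  have h1 := solution_div_lagrangian_lower_bound hM hs hε0 hε1 hβt hβr hβ hψ hsol hr t hK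
  have h2 := div_product_current_lower_bound (Φt := pt (Wc M ψ) t r) (Φr := pr (Wc M ψ) t r)
    (u := ψ t r) hM hr (by positivity : 0 < 1 / (4 * l)) (Wc_eq hM hr ψ t)
  rw [← div_product hM hψ hr t, ← hG] at h2
  rw [← hB] at h1
  rw [pt_currentCt hM hψ hr, pr_currentCr hM hψ hr]
  have hr0 : 0 < r := by linarith
  have hD : Dc M r = qc M r^2 := (qc_sq hM hr).symm
  have hq := qc_pos hM hr
  have hq1 := qc_lt_one hM hr
  have hq2 : qc M r^2 ≤ 1 := pow_le_one₀ hq.le hq1.le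
  rw [hD]
  have k1 : pt (Wc M ψ) t r^2 / r^2 ≤ 1 / (2*M) * (pt (Wc M ψ) t r^2 / (r * qc M r^2)) := by
    have : 1 / (2*M) * (pt (Wc M ψ) t r^2 / (r * qc M r^2))
      = pt (Wc M ψ) t r^2 / (2*M * (r * qc M r^2)) := by field_simp
    rw [this, sq r]
    refine div_le_div_of_nonneg_left (sq_nonneg _) (by positivity) ?_
    nlinarith [mul_le_mul hr.le hq2 (sq_nonneg _) hr0.le, mul_pos hM hr0]
  have k2 : qc M r^2 * pr (Wc M ψ) t r^2 / r^2
      ≤ 1 / (2*M) * (qc M r^2 * pr (Wc M ψ) t r^2 / r) := by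
    have : 1 / (2*M) * (qc M r^2 * pr (Wc M ψ) t r^2 / r)
      = qc M r^2 * pr (Wc M ψ) t r^2 / (2*M * r) := by field_simp
    rw [this, sq r]
    exact div_le_div_of_nonneg_left (by positivity) (by positivity)
      (mul_le_mul_of_nonneg_right hr.le hr0.le)
  have n1 : 0 ≤ qc M r^2 * pr (Wc M ψ) t r^2 / r := by positivity
  have n2 : 0 ≤ (ℓ : ℝ)*((ℓ : ℝ)+1) * Wc M ψ t r^2 / r^3 := by positivity
  have n3 : 0 ≤ Wc M ψ t r^2 / r^3 := by positivity
  have n4 : 0 ≤ pt (Wc M ψ) t r^2 / (r * qc M r^2) := by positivity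
  have n5 : 0 ≤ (ℓ : ℝ)*((ℓ : ℝ)+1) * ψ t r^2 / r^3 := by positivity
  have n6 : 0 ≤ ψ t r^2 / r^3 := by positivity
  have n7 : 0 ≤ pt ψ t r^2 / r^2 := by positivity
  have n8 : 0 ≤ pr ψ t r^2 / r^2 := by positivity
  generalize qc M r^2 * pr (Wc M ψ) t r^2 / r = X at *
  generalize (ℓ : ℝ)*((ℓ : ℝ)+1) * Wc M ψ t r^2 / r^3 = Y' at *
  generalize Wc M ψ t r^2 / r^3 = Y at *
  generalize pt (Wc M ψ) t r^2 / (r * qc M r^2) = Z at *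
  generalize (ℓ : ℝ)*((ℓ : ℝ)+1) * ψ t r^2 / r^3 = V' at *
  generalize ψ t r^2 / r^3 = V at *
  generalize pt ψ t r^2 / r^2 = N₁ at *
  generalize pr ψ t r^2 / r^2 = N₂ at *
  generalize pt (Wc M ψ) t r^2 / r^2 = g₁ at *
  generalize qc M r^2 * pr (Wc M ψ) t r^2 / r^2 = g₂ at *
  generalize pt (lagrangianCt M (Wc M ψ)) t r = a₁ at *
  generalize pr (lagrangianCr M (Wc M ψ)) t r = a₂ at *
  generalize pt (productCt M ψ) t r = b₁ at *
  generalize pr (productCr M ψ) t r = b₂ at *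
  have h3 := mul_le_mul_of_nonneg_left h2 hl0.le
  have e1 : l * (Y / 2 - 1 / (4 * l) * X - G * (Z + (N₁ + N₂) + V))
      = l * Y / 2 - X / 4 - l * G * (Z + (N₁ + N₂) + V) := by
    field_simp
  have h4 : X / 4 + Y' + Y - (B + l * G) * (Z + (N₁ + N₂) + V)
      ≤ l * b₁ - a₁ + (l * b₂ - a₂) := by
    rw [e1, hl] at h3
    rw [hl]
    linarith only [h1, h3]
  have h5 := mul_le_mul_of_nonneg_left h4 (by linarith : 0 ≤ m)
  have h6 : 1 / (2*M) * X ≤ m * (X / 4) := by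
    rw [hm]
    have : 1 / (2*M) * X = 2 / M * (X / 4) := by ring
    rw [this]
    linarith
  have h7 := mul_le_mul_of_nonneg_right hm1 (add_nonneg n2 n3)
  have h8 : 0 ≤ (1 / (2*M)) * ((N₁ + N₂) + V' + V) := by positivity
  have h9 : 0 ≤ m * (B + l * G) * V' := by positivity
  linarith only [k1, k2, h5, h6, h7, h8, h9]

end Pointwise

/-! ### Boundary terms -/

section Boundary

variable {M r : ℝ} {ψ : ℝ → ℝ → ℝ}

lemma abs_lagrangianCt_Wc_le (hM : 0 < M) (hr : 2*M < r) (t : ℝ) :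
    |lagrangianCt M (Wc M ψ) t r| ≤ 2 * (pt (Wc M ψ) t r^2 + Wc M ψ t r^2 / r^2)
      + 2 * (Dc M r * pr (Wc M ψ) t r^2 + 10 * (pt ψ t r^2 + pr ψ t r^2)) := by
  have hr0 : 0 < r := by linarith
  have hM1 := mass_ratio_lt_one hM hr
  have hM2 : 0 < 2*M/r := by positivity
  have hD : Dc M r = qc M r^2 := (qc_sq hM hr).symm
  have e : lagrangianCt M (Wc M ψ) t r
      = (1 + 2*M/r) * pt (Wc M ψ) t r * (Wc M ψ t r / r)
        - (2 * (2*M/r)) * (qc M r * pr (Wc M ψ) t r) * (alphac M r * pt ψ t r + pr ψ t r) := by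
    have h : 2 * (2*M/r) * (qc M r * pr (Wc M ψ) t r) * (alphac M r * pt ψ t r + pr ψ t r)
        = 4*M/r^2 * (pr (Wc M ψ) t r * Wc M ψ t r) := by
      rw [Wc_eq hM hr ψ t]
      field_simp
      ring
    rw [h, lagrangianCt]
    field_simp
  have h1 : |1 + 2*M/r| ≤ 2 := by
    rw [abs_of_pos (by positivity)]
    linarith
  have h2 : |2 * (2*M/r)| ≤ 2 := by
    rw [abs_of_pos (by positivity)]
    linarith
  have h3 := abs_mul_mul_le h1 (pt (Wc M ψ) t r) (Wc M ψ t r / r)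
  have h4 := abs_mul_mul_le h2 (qc M r * pr (Wc M ψ) t r) (alphac M r * pt ψ t r + pr ψ t r)
  have h5 := sq_mul_add_le (alphac_nonneg hM hr) (alphac_le hM hr) (pt ψ t r) (pr ψ t r)
  rw [div_pow] at h3
  rw [mul_pow, ← hD] at h4
  rw [e]
  refine (abs_sub _ _).trans ?_
  linarith

lemma abs_productCt_le (hM : 0 < M) (hr : 2*M < r) (t : ℝ) :
    |productCt M ψ t r| ≤ 3 * (Wc M ψ t r^2 / r^2 + ψ t r^2 / r^2) := by
  have hr0 : 0 < r := by linarith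
  have h1 : |qc M r * alphac M r| ≤ 3 := by
    have h := abs_mul_le_of_le (abs_of_pos (qc_pos hM hr)).le
      (abs_of_nonneg (alphac_nonneg hM hr)).le
    have := mul_le_mul (qc_lt_one hM hr).le (alphac_le hM hr) (alphac_nonneg hM hr) zero_le_one
    linarith
  have e : productCt M ψ t r = qc M r * alphac M r * (Wc M ψ t r / r) * (ψ t r / r) := by
    rw [productCt]
    field_simp
  have h2 := abs_mul_mul_le h1 (Wc M ψ t r / r) (ψ t r / r)
  rwa [← e, div_pow, div_pow] at h2

lemma abs_currentCt_le (ℓ : ℕ) (hM : 0 < M) (hr : 2*M < r) {l m : ℝ} (hl : 0 ≤ l) (hm : 0 ≤ m)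
    (t : ℝ) :
    |currentCt M l m ψ t r| ≤ m * (3 * l + 20) *
      ((pt (Wc M ψ) t r^2 + Dc M r * pr (Wc M ψ) t r^2
          + (ℓ : ℝ)*((ℓ : ℝ)+1) * Wc M ψ t r^2 / r^2 + Wc M ψ t r^2 / r^2)
        + (pt ψ t r^2 + pr ψ t r^2 + (ℓ : ℝ)*((ℓ : ℝ)+1) * ψ t r^2 / r^2 + ψ t r^2 / r^2)) := by
  have h1 := abs_lagrangianCt_Wc_le (ψ := ψ) hM hr t
  have h2 := abs_productCt_le (ψ := ψ) hM hr t
  have hD := (Dc_pos hM hr).le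
  have n1 : 0 ≤ pt (Wc M ψ) t r^2 := sq_nonneg _
  have n2 : 0 ≤ Dc M r * pr (Wc M ψ) t r^2 := by positivity
  have n3 : 0 ≤ (ℓ : ℝ)*((ℓ : ℝ)+1) * Wc M ψ t r^2 / r^2 := by positivity
  have n4 : 0 ≤ Wc M ψ t r^2 / r^2 := by positivity
  have n5 : 0 ≤ pt ψ t r^2 := sq_nonneg _
  have n6 : 0 ≤ pr ψ t r^2 := sq_nonneg _
  have n7 : 0 ≤ (ℓ : ℝ)*((ℓ : ℝ)+1) * ψ t r^2 / r^2 := by positivity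
  have n8 : 0 ≤ ψ t r^2 / r^2 := by positivity
  rw [currentCt, abs_mul, abs_of_nonneg hm, mul_assoc]
  refine mul_le_mul_of_nonneg_left ?_ hm
  refine (abs_sub _ _).trans ?_
  rw [abs_mul, abs_of_nonneg hl]
  have h3 := mul_le_mul_of_nonneg_left h2 hl
  generalize pt (Wc M ψ) t r^2 = a₁ at *
  generalize Dc M r * pr (Wc M ψ) t r^2 = a₂ at *
  generalize (ℓ : ℝ)*((ℓ : ℝ)+1) * Wc M ψ t r^2 / r^2 = a₃ at *
  generalize Wc M ψ t r^2 / r^2 = a₄ at *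
  generalize pt ψ t r^2 = a₅ at *
  generalize pr ψ t r^2 = a₆ at *
  generalize (ℓ : ℝ)*((ℓ : ℝ)+1) * ψ t r^2 / r^2 = a₇ at *
  generalize ψ t r^2 / r^2 = a₈ at *
  have h4 : 0 ≤ l * (a₁ + a₂ + a₃ + a₅ + a₆ + a₇) := by positivity
  linarith

lemma currentCr_eq_zero {R : ℝ} {a b : ℝ} (hM : 0 < M) (hr : 2*M < r)
    (h : ∀ t r : ℝ, t ∈ Icc a b → R ≤ r → ψ t r = 0) (hR : R < r) {t : ℝ} (ht : t ∈ Ioo a b)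
    (l m : ℝ) : currentCr M l m ψ t r = 0 := by
  have h0 : ψ t r = 0 := h t r (Ioo_subset_Icc_self ht) hR.le
  have h1 : pt ψ t r = 0 := by
    have : (fun t' => ψ t' r) =ᶠ[𝓝 t] fun _ => 0 := by
      filter_upwards [Ioo_mem_nhds ht.1 ht.2] with t' ht'
        using h t' r (Ioo_subset_Icc_self ht') hR.le
    rw [pt, this.deriv_eq, deriv_const]
  have h2 : pr ψ t r = 0 := by
    have : (fun r' => ψ t r') =ᶠ[𝓝 r] fun _ => 0 := by
      filter_upwards [Ioi_mem_nhds hR] with r' hr'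
        using h t r' (Ioo_subset_Icc_self ht) (le_of_lt hr')
    rw [pr, this.deriv_eq, deriv_const]
  have h3 : Wc M ψ t r = 0 := by
    rw [Wc_eq hM hr, h1, h2]
    ring
  simp [currentCr, productCr, lagrangianCr, h3]

lemma exists_abs_currentCr_le (hM : 0 < M) (hψ : SmoothOnRegion ψ (Ici (2*M))) (l m t₁ t₂ R : ℝ) :
    ∃ K, 0 ≤ K ∧ ∀ t ∈ Icc t₁ t₂, ∀ r, 2*M < r → r ≤ R →
      |currentCr M l m ψ t r| ≤ K * qc M r := by
  obtain ⟨v₁, hv₁, e₁⟩ := hψ.exists_pt_extension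
  obtain ⟨v₂, hv₂, e₂⟩ := hψ.exists_pr_extension
  obtain ⟨v₃, hv₃, e₃⟩ := hv₁.exists_pr_extension
  obtain ⟨v₄, hv₄, e₄⟩ := hv₂.exists_pr_extension
  obtain ⟨K₀, b₀⟩ := hψ.exists_bound t₁ t₂ R
  obtain ⟨K₁, b₁⟩ := hv₁.exists_bound t₁ t₂ R
  obtain ⟨K₂, b₂⟩ := hv₂.exists_bound t₁ t₂ R
  obtain ⟨K₃, b₃⟩ := hv₃.exists_bound t₁ t₂ R
  obtain ⟨K₄, b₄⟩ := hv₄.exists_bound t₁ t₂ R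
  refine ⟨|m| * (|l| * ((3 * |K₁| + |K₂|) / (2*M) * |K₀|) + (1 * (3 * |K₁| + |K₂|) +
    (9/4 * |K₁| + |R| * (3 * |K₃| + |K₄|))) * (3 * |K₁| + |K₂|)), by positivity, ?_⟩
  intro t ht r hr hrR
  have hr0 : 0 < r := by linarith
  have hq := qc_pos hM hr
  have hq1 := qc_lt_one hM hr
  have hα : |alphac M r| ≤ 3 := by
    rw [abs_of_nonneg (alphac_nonneg hM hr)]
    exact alphac_le hM hr
  have hmem : r ∈ Icc (2*M) R := ⟨hr.le, hrR⟩
  have c₀ := (b₀ t ht r hmem).trans (le_abs_self _)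
  have c₁ := (b₁ t ht r hmem).trans (le_abs_self _)
  have c₂ := (b₂ t ht r hmem).trans (le_abs_self _)
  have c₃ := (b₃ t ht r hmem).trans (le_abs_self _)
  have c₄ := (b₄ t ht r hmem).trans (le_abs_self _)
  rw [← e₁ t r hr] at c₁
  rw [← e₂ t r hr] at c₂
  rw [← e₃ t r hr, ← pr_congr e₁ hr] at c₃
  rw [← e₄ t r hr, ← pr_congr e₂ hr] at c₄
  have d₁ : |alphac M r * pt ψ t r + pr ψ t r| ≤ 3 * |K₁| + |K₂| :=
    (abs_add_le _ _).trans (add_le_add (abs_mul_le_of_le hα c₁) c₂)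
  have d₂ : |r * alphac1 M r * pt ψ t r + r * (alphac M r * pr (pt ψ) t r + pr (pr ψ) t r)|
      ≤ 9/4 * |K₁| + |R| * (3 * |K₃| + |K₄|) := by
    refine (abs_add_le _ _).trans (add_le_add (abs_mul_le_of_le ?_ c₁) (abs_mul_le_of_le ?_
      ((abs_add_le _ _).trans (add_le_add (abs_mul_le_of_le hα c₃) c₄))))
    · rw [abs_mul, abs_of_pos hr0]
      exact abs_alphac1_le hM hr
    · rw [abs_of_pos hr0]
      exact hrR.trans (le_abs_self _)
  have hq2 : |qc M r^2| ≤ 1 := by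
    rw [abs_of_pos (by positivity)]
    exact pow_le_one₀ hq.le hq1.le
  have hqb : |qc M r * bc1 M r| ≤ 1 := by
    have h1 := mass_ratio_lt_one hM hr
    have h2 : 0 < 2*M/r := by positivity
    have h3 : M/r = (2*M/r)/2 := by ring
    rw [qc_mul_bc1 hM hr, abs_le]
    constructor <;> linarith
  have d₃ : |qc M r * pr (Wc M ψ) t r| ≤ 1 * (3 * |K₁| + |K₂|) +
      (9/4 * |K₁| + |R| * (3 * |K₃| + |K₄|)) := by
    have e : qc M r * pr (Wc M ψ) t r = qc M r * bc1 M r * (alphac M r * pt ψ t r + pr ψ t r)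
        + qc M r^2 * (r * alphac1 M r * pt ψ t r
          + r * (alphac M r * pr (pt ψ) t r + pr (pr ψ) t r)) := by
      rw [pr_Wc hM (hψ.mono Ioi_subset_Ici_self) hr]
      ring
    rw [e]
    refine (abs_add_le _ _).trans (add_le_add (abs_mul_le_of_le hqb d₁) ?_)
    simpa using abs_mul_le_of_le hq2 d₂
  have d₄ : |qc M r * ((alphac M r * pt ψ t r + pr ψ t r) / r * ψ t r)|
      ≤ (3 * |K₁| + |K₂|) / (2*M) * |K₀| := by
    have h1 : |(alphac M r * pt ψ t r + pr ψ t r) / r| ≤ (3 * |K₁| + |K₂|) / (2*M) := by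
      rw [abs_div, abs_of_pos hr0]
      exact div_le_div₀ (by positivity) d₁ (by positivity) hr.le
    have h2 := abs_mul_le_of_le (X := 1) (x := qc M r) ((abs_of_pos hq).trans_le hq1.le)
      (abs_mul_le_of_le h1 c₀)
    linarith
  have hD : Dc M r = qc M r^2 := (qc_sq hM hr).symm
  have d₅ : |qc M r * (alphac M r * pt ψ t r + pr ψ t r)| ≤ 1 * (3 * |K₁| + |K₂|) :=
    abs_mul_le_of_le ((abs_of_pos hq).trans_le hq1.le) d₁
  have e : currentCr M l m ψ t r = m * (l * (qc M r * ((alphac M r * pt ψ t r + pr ψ t r) / r *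
      ψ t r)) + qc M r * pr (Wc M ψ) t r * (qc M r * (alphac M r * pt ψ t r + pr ψ t r))) *
      qc M r := by
    rw [currentCr, productCr, lagrangianCr, Wc_eq hM hr ψ t, hD]
    field_simp
    ring
  rw [e, abs_mul, abs_of_pos hq]
  refine mul_le_mul_of_nonneg_right (abs_mul_le_of_le le_rfl ?_) hq.le
  refine (abs_add_le _ _).trans (add_le_add (abs_mul_le_of_le le_rfl d₄) ?_)
  simpa only [one_mul] using abs_mul_le_of_le d₃ d₅

end Boundary

/-! ### Integrating a pointwise estimate with a divergence -/

section Integration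

variable {a T : ℝ}

lemma SmoothOnRegion.continuousOn {u : ℝ → ℝ → ℝ} {S : Set ℝ} (hu : SmoothOnRegion u S) :
    ContinuousOn (Function.uncurry u) (univ ×ˢ S) := ContDiffOn.continuousOn hu

lemma continuousOn_slice {u : ℝ → ℝ → ℝ} {S : Set ℝ}
    (hu : ContinuousOn (Function.uncurry u) (univ ×ˢ S)) (t : ℝ) : ContinuousOn (u t) S :=
  hu.comp (by fun_prop : ContinuousOn (fun r : ℝ => (t, r)) S) fun _ hr => ⟨mem_univ _, hr⟩

lemma Icc_prod_subset {b c : ℝ} (hab : a < b) :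
    Icc ((0 : ℝ), b) (T, c) ⊆ univ ×ˢ Ioi a := fun _ hx =>
  ⟨mem_univ _, hab.trans_le hx.1.2⟩

lemma integral_divergence_le {Jt Jr : ℝ → ℝ → ℝ} (hT : 0 ≤ T)
    (hJt : SmoothOnRegion Jt (Ioi a)) (hJr : SmoothOnRegion Jr (Ioi a))
    {b c δ : ℝ} (hab : a < b) (hbc : b ≤ c) (hc : ∀ t ∈ Icc 0 T, Jr t c = 0)
    (hb : ∀ t ∈ Icc 0 T, |Jr t b| ≤ δ) :
    ∫ x in Icc ((0 : ℝ), b) (T, c), (pt Jt x.1 x.2 + pr Jr x.1 x.2) ≤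
      (∫ r in b..c, |Jt T r|) + (∫ r in b..c, |Jt 0 r|) + δ * T := by
  have hsub := Icc_prod_subset (T := T) (c := c) hab
  have hcont : ContinuousOn (fun x : ℝ × ℝ => pt Jt x.1 x.2 + pr Jr x.1 x.2)
      (Icc ((0 : ℝ), b) (T, c)) :=
    (hJt.pt.continuousOn.mono hsub).add (hJr.pr.continuousOn.mono hsub)
  have e : ∀ x ∈ Icc ((0 : ℝ), b) (T, c), pt Jt x.1 x.2 + pr Jr x.1 x.2 =
      fderiv ℝ (Function.uncurry Jt) x (1, 0) + fderiv ℝ (Function.uncurry Jr) x (0, 1) :=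
    fun x hx => by rw [hJt.pt_eq (hsub hx).2, hJr.pr_eq (hsub hx).2]
  have hd : ∀ u : ℝ → ℝ → ℝ, SmoothOnRegion u (Ioi a) → ∀ x ∈ Ioo (0:ℝ) T ×ˢ Ioo b c,
      HasFDerivAt (Function.uncurry u) (fderiv ℝ (Function.uncurry u) x) x :=
    fun u hu x hx => (hu.differentiableAt (r := x.2) (hab.trans hx.2.1)).hasFDerivAt
  have key := integral_divergence_prod_Icc_of_hasFDerivAt_of_le
    (Function.uncurry Jt) (Function.uncurry Jr) (fderiv ℝ (Function.uncurry Jt))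
    (fderiv ℝ (Function.uncurry Jr)) ((0 : ℝ), b) (T, c) ⟨hT, hbc⟩
    (hJt.continuousOn.mono hsub) (hJr.continuousOn.mono hsub) (hd Jt hJt) (hd Jr hJr)
    ((hcont.congr fun x hx => (e x hx).symm).integrableOn_compact isCompact_Icc)
  rw [setIntegral_congr_fun measurableSet_Icc e, key]
  have h1 : ∫ x in (0:ℝ)..T, Function.uncurry Jr (x, c) = 0 := by
    have hz : EqOn (fun x => Function.uncurry Jr (x, c)) (fun _ => 0) (uIcc 0 T) := fun t ht =>
      hc t (by rwa [uIcc_of_le hT] at ht)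
    simpa using intervalIntegral.integral_congr (μ := volume) hz
  have h2 : ‖∫ x in (0:ℝ)..T, Function.uncurry Jr (x, b)‖ ≤ δ * |T - 0| :=
    intervalIntegral.norm_integral_le_of_norm_le_const fun t ht => hb t (by
      rw [uIoc_of_le hT] at ht
      exact Ioc_subset_Icc_self ht)
  have h3 : |∫ r in b..c, Function.uncurry Jt (T, r)| ≤ ∫ r in b..c, |Jt T r| :=
    intervalIntegral.abs_integral_le_integral_abs hbc
  have h4 : |∫ r in b..c, Function.uncurry Jt (0, r)| ≤ ∫ r in b..c, |Jt 0 r| :=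
    intervalIntegral.abs_integral_le_integral_abs hbc
  rw [Real.norm_eq_abs, sub_zero, abs_of_nonneg hT] at h2
  rw [abs_le] at h2 h3 h4
  simp only [h1]
  linarith [h2.1, h3.2, h4.1]

lemma lintegral_box_le {g h Jt Jr e : ℝ → ℝ → ℝ} {A B : ℝ} (hT : 0 ≤ T) (hA : 0 ≤ A) (hB : 0 ≤ B)
    (hg : ContinuousOn (Function.uncurry g) (univ ×ˢ Ioi a))
    (hh : ContinuousOn (Function.uncurry h) (univ ×ˢ Ioi a))
    (he : ContinuousOn (Function.uncurry e) (univ ×ˢ Ioi a))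
    (g0 : ∀ t r, a < r → 0 ≤ g t r) (h0 : ∀ t r, a < r → 0 ≤ h t r)
    (e0 : ∀ t r, a < r → 0 ≤ e t r)
    (hJt : SmoothOnRegion Jt (Ioi a)) (hJr : SmoothOnRegion Jr (Ioi a))
    (hp : ∀ t r, a < r → g t r ≤ A * h t r + (pt Jt t r + pr Jr t r))
    (hJe : ∀ t r, a < r → |Jt t r| ≤ B * e t r)
    {b c δ : ℝ} (hab : a < b) (hbc : b ≤ c) (hc : ∀ t ∈ Icc 0 T, Jr t c = 0)
    (hb : ∀ t ∈ Icc 0 T, |Jr t b| ≤ δ) :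
    ∫⁻ x in Icc ((0 : ℝ), b) (T, c), ENNReal.ofReal (g x.1 x.2) ≤
      ENNReal.ofReal A * (∫⁻ x in Icc ((0 : ℝ), b) (T, c), ENNReal.ofReal (h x.1 x.2))
        + ENNReal.ofReal B * ((∫⁻ r in Ioi a, ENNReal.ofReal (e T r))
          + ∫⁻ r in Ioi a, ENNReal.ofReal (e 0 r))
        + ENNReal.ofReal (δ * T) := by
  have hsub := Icc_prod_subset (T := T) (c := c) hab
  have ig := (hg.mono hsub).integrableOn_compact (μ := volume) isCompact_Icc
  have ih := (hh.mono hsub).integrableOn_compact (μ := volume) isCompact_Icc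
  have ij := ((hJt.pt.continuousOn.mono hsub).add
    (hJr.pr.continuousOn.mono hsub)).integrableOn_compact (μ := volume) isCompact_Icc
  have hδ : 0 ≤ δ := (abs_nonneg _).trans (hb 0 ⟨le_rfl, hT⟩)
  have slice : ∀ t, (∫ r in b..c, |Jt t r|) ≤ B * ∫ r in b..c, e t r := fun t => by
    have hs : uIcc b c ⊆ Ioi a := by
      rw [uIcc_of_le hbc]
      exact fun r hr => hab.trans_le hr.1
    rw [← intervalIntegral.integral_const_mul]
    exact intervalIntegral.integral_mono_on hbc
      ((continuousOn_slice hJt.continuousOn t).mono hs).abs.intervalIntegrable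
      ((((continuousOn_slice he t).mono hs).intervalIntegrable).const_mul B)
      fun r hr => hJe t r (hab.trans_le hr.1)
  have slice' : ∀ t, 0 ≤ (∫ r in b..c, e t r) ∧
      ENNReal.ofReal (∫ r in b..c, e t r) ≤ ∫⁻ r in Ioi a, ENNReal.ofReal (e t r) := fun t => by
    have hs : Icc b c ⊆ Ioi a := fun r hr => hab.trans_le hr.1
    have hn : ∀ r ∈ Ioc b c, 0 ≤ e t r := fun r hr => e0 t r (hab.trans hr.1)
    rw [intervalIntegral.integral_of_le hbc]
    refine ⟨setIntegral_nonneg measurableSet_Ioc hn, ?_⟩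
    rw [ofReal_integral_eq_lintegral_ofReal ((((continuousOn_slice he t).mono
      hs).integrableOn_compact isCompact_Icc).mono_set Ioc_subset_Icc_self)
      ((ae_restrict_iff' measurableSet_Ioc).2 (ae_of_all _ hn))]
    exact lintegral_mono_set (Ioc_subset_Icc_self.trans hs)
  have main : ∫ x in Icc ((0 : ℝ), b) (T, c), g x.1 x.2 ≤
      A * (∫ x in Icc ((0 : ℝ), b) (T, c), h x.1 x.2)
        + B * ((∫ r in b..c, e T r) + ∫ r in b..c, e 0 r) + δ * T := by
    have h1 : ∫ x in Icc ((0 : ℝ), b) (T, c), g x.1 x.2 ≤ ∫ x in Icc ((0 : ℝ), b) (T, c),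
        (A * h x.1 x.2 + (pt Jt x.1 x.2 + pr Jr x.1 x.2)) :=
      setIntegral_mono_on ig ((ih.const_mul A).add ij) measurableSet_Icc
        fun x hx => hp x.1 x.2 (hsub hx).2
    have h2 : ∫ x in Icc ((0 : ℝ), b) (T, c), (A * h x.1 x.2 + (pt Jt x.1 x.2 + pr Jr x.1 x.2)) =
        A * (∫ x in Icc ((0 : ℝ), b) (T, c), h x.1 x.2)
          + ∫ x in Icc ((0 : ℝ), b) (T, c), (pt Jt x.1 x.2 + pr Jr x.1 x.2) := by
      rw [← integral_const_mul]
      exact integral_add (ih.const_mul A) ij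
    have h3 := integral_divergence_le hT hJt hJr hab hbc hc hb
    linarith [slice T, slice 0]
  have cg := ofReal_integral_eq_lintegral_ofReal ig
    ((ae_restrict_iff' measurableSet_Icc).2 (ae_of_all _ fun x hx => g0 x.1 x.2 (hsub hx).2))
  have ch := ofReal_integral_eq_lintegral_ofReal ih
    ((ae_restrict_iff' measurableSet_Icc).2 (ae_of_all _ fun x hx => h0 x.1 x.2 (hsub hx).2))
  have ih0 : 0 ≤ ∫ x in Icc ((0 : ℝ), b) (T, c), h x.1 x.2 :=
    setIntegral_nonneg measurableSet_Icc fun x hx => h0 x.1 x.2 (hsub hx).2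
  have sT := (slice' T).1
  have s0 := (slice' 0).1
  calc ∫⁻ x in Icc ((0 : ℝ), b) (T, c), ENNReal.ofReal (g x.1 x.2)
      = ENNReal.ofReal (∫ x in Icc ((0 : ℝ), b) (T, c), g x.1 x.2) := cg.symm
    _ ≤ _ := ENNReal.ofReal_le_ofReal main
    _ = ENNReal.ofReal A * ENNReal.ofReal (∫ x in Icc ((0 : ℝ), b) (T, c), h x.1 x.2)
        + ENNReal.ofReal B * (ENNReal.ofReal (∫ r in b..c, e T r)
          + ENNReal.ofReal (∫ r in b..c, e 0 r)) + ENNReal.ofReal (δ * T) := by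
      rw [ENNReal.ofReal_add (by positivity) (by positivity),
        ENNReal.ofReal_add (by positivity) (by positivity), ENNReal.ofReal_mul hA,
        ENNReal.ofReal_mul hB, ENNReal.ofReal_add sT s0]
    _ ≤ _ := add_le_add_left (add_le_add (mul_le_mul_right ch.le _)
        (mul_le_mul_right (add_le_add (slice' T).2 (slice' 0).2) _)) _

lemma aecover_boxes {R : ℝ} :
    AECover (volume.restrict (Icc (0:ℝ) T ×ˢ Ioi a)) atTop
      fun n : ℕ => Icc ((0 : ℝ), a + 1 / ((n : ℝ) + 1)) (T, max R a + ((n : ℝ) + 1)) where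
  measurableSet _ := measurableSet_Icc
  ae_eventually_mem := by
    rw [ae_restrict_iff' (measurableSet_Icc.prod measurableSet_Ioi)]
    refine ae_of_all _ fun x hx => ?_
    have hx2 : a < x.2 := hx.2
    have h1 : ∀ᶠ n : ℕ in atTop, 1 / ((n : ℝ) + 1) < x.2 - a :=
      tendsto_one_div_add_atTop_nhds_zero_nat.eventually (gt_mem_nhds (sub_pos.2 hx2))
    have h2 : ∀ᶠ n : ℕ in atTop, x.2 - max R a ≤ (n : ℝ) :=
      tendsto_natCast_atTop_atTop.eventually_ge_atTop _
    filter_upwards [h1, h2] with n hn1 hn2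
    refine ⟨⟨hx.1.1, ?_⟩, ⟨hx.1.2, ?_⟩⟩
    · change a + 1 / ((n : ℝ) + 1) ≤ x.2
      linarith
    · change x.2 ≤ max R a + ((n : ℝ) + 1)
      linarith

lemma lintegral_region_eq {f : ℝ → ℝ → ℝ}
    (hf : ContinuousOn (Function.uncurry f) (univ ×ˢ Ioi a)) :
    AEMeasurable (fun x : ℝ × ℝ => ENNReal.ofReal (f x.1 x.2))
      (volume.restrict (Icc (0:ℝ) T ×ˢ Ioi a)) ∧
    ∫⁻ t in Ioc 0 T, ∫⁻ r in Ioi a, ENNReal.ofReal (f t r) =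
      ∫⁻ x in Icc (0:ℝ) T ×ˢ Ioi a, ENNReal.ofReal (f x.1 x.2) := by
  have hm : AEMeasurable (fun x : ℝ × ℝ => ENNReal.ofReal (f x.1 x.2))
      (volume.restrict (Icc (0:ℝ) T ×ˢ Ioi a)) :=
    ((hf.mono (prod_mono_left (subset_univ _))).aemeasurable
      (measurableSet_Icc.prod measurableSet_Ioi)).ennreal_ofReal
  refine ⟨hm, ?_⟩
  rw [restrict_Ioc_eq_restrict_Icc]
  rw [Measure.volume_eq_prod] at hm ⊢
  exact (setLIntegral_prod _ hm).symm

/-- Integration of a pointwise estimate up to a divergence, when the radial flux vanishes at the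
inner boundary and for large radius. -/
theorem lintegral_le_of_pointwise {g h Jt Jr e : ℝ → ℝ → ℝ} {A B : ℝ} (hT : 0 ≤ T) (hA : 0 ≤ A)
    (hB : 0 ≤ B)
    (hg : ContinuousOn (Function.uncurry g) (univ ×ˢ Ioi a))
    (hh : ContinuousOn (Function.uncurry h) (univ ×ˢ Ioi a))
    (he : ContinuousOn (Function.uncurry e) (univ ×ˢ Ioi a))
    (g0 : ∀ t r, a < r → 0 ≤ g t r) (h0 : ∀ t r, a < r → 0 ≤ h t r)
    (e0 : ∀ t r, a < r → 0 ≤ e t r)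
    (hJt : SmoothOnRegion Jt (Ioi a)) (hJr : SmoothOnRegion Jr (Ioi a))
    (hp : ∀ t r, a < r → g t r ≤ A * h t r + (pt Jt t r + pr Jr t r))
    (hJe : ∀ t r, a < r → |Jt t r| ≤ B * e t r)
    {R : ℝ} (hR : ∀ t ∈ Icc 0 T, ∀ r, a < r → R < r → Jr t r = 0)
    {δ : ℝ → ℝ} (hδ : Tendsto δ (𝓝[>] a) (𝓝 0))
    (hJδ : ∀ t ∈ Icc 0 T, ∀ r, a < r → r ≤ a + 1 → |Jr t r| ≤ δ r) :
    ∫⁻ t in Ioc 0 T, ∫⁻ r in Ioi a, ENNReal.ofReal (g t r) ≤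
      ENNReal.ofReal A * (∫⁻ t in Ioc 0 T, ∫⁻ r in Ioi a, ENNReal.ofReal (h t r))
        + ENNReal.ofReal B * ((∫⁻ r in Ioi a, ENNReal.ofReal (e T r))
          + ∫⁻ r in Ioi a, ENNReal.ofReal (e 0 r)) := by
  obtain ⟨mg, eg⟩ := lintegral_region_eq (T := T) hg
  obtain ⟨-, eh⟩ := lintegral_region_eq (T := T) hh
  rw [eg, eh]
  set S := Icc (0:ℝ) T ×ˢ Ioi a
  have hS : MeasurableSet S := measurableSet_Icc.prod measurableSet_Ioi
  have hpos (n : ℕ) : 0 < 1 / ((n : ℝ) + 1) := by positivity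
  have hlim : Tendsto (fun n : ℕ => a + 1 / ((n : ℝ) + 1)) atTop (𝓝[>] a) := by
    refine tendsto_nhdsWithin_iff.2 ⟨?_, .of_forall fun n => ?_⟩
    · simpa using tendsto_one_div_add_atTop_nhds_zero_nat.const_add a
    · exact lt_add_of_pos_right a (hpos n)
  have herr : Tendsto (fun n : ℕ => ENNReal.ofReal (δ (a + 1 / ((n : ℝ) + 1)) * T)) atTop (𝓝 0) := by
    simpa using ENNReal.tendsto_ofReal ((hδ.comp hlim).mul_const T)
  refine le_of_tendsto_of_tendsto
    ((aecover_boxes (R := R)).lintegral_tendsto_of_countably_generated mg)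
    (by
      have := herr.const_add (ENNReal.ofReal A * (∫⁻ x in S, ENNReal.ofReal (h x.1 x.2))
        + ENNReal.ofReal B * ((∫⁻ r in Ioi a, ENNReal.ofReal (e T r))
          + ∫⁻ r in Ioi a, ENNReal.ofReal (e 0 r)))
      rwa [add_zero] at this) (.of_forall fun n => ?_)
  have hn := hpos n
  have hn1 : 1 / ((n : ℝ) + 1) ≤ 1 := by
    rw [div_le_one (by positivity)]
    linarith [(Nat.cast_nonneg n : (0:ℝ) ≤ n)]
  have hca : a + 1 / ((n : ℝ) + 1) ≤ max R a + ((n : ℝ) + 1) := by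
    linarith [le_max_right R a, (Nat.cast_nonneg n : (0:ℝ) ≤ n)]
  have hcR : R < max R a + ((n : ℝ) + 1) := by
    linarith [le_max_left R a, (Nat.cast_nonneg n : (0:ℝ) ≤ n)]
  have hbox := lintegral_box_le hT hA hB hg hh he g0 h0 e0 hJt hJr hp hJe
    (lt_add_of_pos_right a hn) hca (fun t ht => hR t ht _ (by linarith) hcR)
    (fun t ht => hJδ t ht _ (by linarith) (by linarith))
  have hsub : Icc ((0 : ℝ), a + 1 / ((n : ℝ) + 1)) (T, max R a + ((n : ℝ) + 1)) ⊆ S := fun x hx =>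
    ⟨⟨hx.1.1, hx.2.1⟩, (lt_add_of_pos_right a hn).trans_le hx.1.2⟩
  refine (lintegral_mono' (Measure.restrict_mono_measure Measure.restrict_le_self _) le_rfl).trans
    (hbox.trans ?_)
  exact add_le_add_left (add_le_add_left (mul_le_mul_right (lintegral_mono_set hsub) _) _) _

end Integration

section Main

lemma continuousOn_uncurry_add {f g : ℝ → ℝ → ℝ} {S : Set (ℝ × ℝ)}
    (hf : ContinuousOn (Function.uncurry f) S) (hg : ContinuousOn (Function.uncurry g) S) :
    ContinuousOn (Function.uncurry fun t r => f t r + g t r) S := hf.add hg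

lemma lintegral_region_add_le {a T : ℝ} {f g : ℝ → ℝ → ℝ}
    (hf : ContinuousOn (Function.uncurry f) (univ ×ˢ Ioi a))
    (hg : ContinuousOn (Function.uncurry g) (univ ×ˢ Ioi a)) :
    ∫⁻ t in Ioc 0 T, ∫⁻ r in Ioi a, ENNReal.ofReal (f t r + g t r) ≤
      (∫⁻ t in Ioc 0 T, ∫⁻ r in Ioi a, ENNReal.ofReal (f t r)) +
        ∫⁻ t in Ioc 0 T, ∫⁻ r in Ioi a, ENNReal.ofReal (g t r) := by
  obtain ⟨mf, ef⟩ := lintegral_region_eq (T := T) hf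
  rw [ef, (lintegral_region_eq (T := T) hg).2,
    (lintegral_region_eq (T := T) (continuousOn_uncurry_add hf hg)).2,
    ← lintegral_add_left' mf]
  exact lintegral_mono fun x => ENNReal.ofReal_add_le

lemma lintegral_slice_add_le {a : ℝ} {f g : ℝ → ℝ} (hf : ContinuousOn f (Ioi a)) :
    ∫⁻ r in Ioi a, ENNReal.ofReal (f r + g r) ≤
      (∫⁻ r in Ioi a, ENNReal.ofReal (f r)) + ∫⁻ r in Ioi a, ENNReal.ofReal (g r) := by
  rw [← lintegral_add_left' (hf.aemeasurable measurableSet_Ioi).ennreal_ofReal]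
  exact lintegral_mono fun x => ENNReal.ofReal_add_le

variable {M : ℝ} {u v w : ℝ → ℝ → ℝ}

lemma tendsto_qc (hM : 0 < M) : Tendsto (qc M) (𝓝[>] (2*M)) (𝓝 0) := by
  have h : ContinuousAt (qc M) (2*M) :=
    (hasDerivAt_Dc (by positivity : 2*M ≠ 0)).continuousAt.sqrt
  have h0 : qc M (2*M) = 0 := by
    rw [qc, Dc, div_self (by positivity), sub_self, Real.sqrt_zero]
  exact h0 ▸ h.tendsto.mono_left nhdsWithin_le_nhds

/-- A weighted sum of squares, the common form of the energy densities, is continuous. -/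
lemma continuousOn_weighted_squares {a b c d : ℝ → ℝ} {S : Set ℝ}
    (ha : ContinuousOn a S) (hb : ContinuousOn b S) (hc : ContinuousOn c S) (hd : ContinuousOn d S)
    (hu : SmoothOnRegion u S) (hv : SmoothOnRegion v S) (hw : SmoothOnRegion w S) :
    ContinuousOn (Function.uncurry fun t r =>
      a r * u t r^2 + b r * v t r^2 + c r * w t r^2 + d r * w t r^2) (univ ×ˢ S) := by
  have radial {f : ℝ → ℝ} (hf : ContinuousOn f S) :
      ContinuousOn (fun y : ℝ × ℝ => f y.2) ((univ : Set ℝ) ×ˢ S) :=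
    hf.comp continuousOn_snd fun _ hy => hy.2
  exact ((((radial ha).mul (hu.continuousOn.pow 2)).add
    ((radial hb).mul (hv.continuousOn.pow 2))).add
    ((radial hc).mul (hw.continuousOn.pow 2))).add ((radial hd).mul (hw.continuousOn.pow 2))

lemma continuousOn_energy_density (hM : 0 < M) {b : ℝ → ℝ} (hb : ContinuousOn b (Ioi (2*M))) (k : ℝ)
    (i j : ℕ) (hu : SmoothOnRegion u (Ioi (2*M))) :
    ContinuousOn (Function.uncurry fun t r =>
      pt u t r^2/r^i + b r * pr u t r^2/r^i + k * u t r^2/r^j + u t r^2/r^j)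
      (univ ×ˢ Ioi (2*M)) := by
  have h := fun (c : ℝ) (n : ℕ) => (contDiffOn_const_div_pow hM c n).continuousOn
  exact (continuousOn_weighted_squares (h 1 i) (hb.mul (h 1 i)) (h k j) (h 1 j) hu.pt hu.pr
    hu).congr fun _ _ => by
      simp only [Function.uncurry, Pi.mul_apply]
      ring

end Main

/-- **Eq. (12): mode-reduced Lagrangian estimate.** -/
theorem lagrangian_estimate (M C : ℝ) (hM : 0 < M) (hC : 0 < C) (s : ℕ) (hs : s ≤ 2) :
    ∃ Ct : ℝ, 0 < Ct ∧
      ∀ (ℓ : ℕ), s ≤ ℓ →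
      ∀ ε : ℝ, 0 ≤ ε → ε ≤ 1 →
      ∀ βt βr ψ : ℝ → ℝ → ℝ,
        SmoothOnRegion βt (Ioi (2*M)) → SmoothOnRegion βr (Ioi (2*M)) →
        BetaBounds M C βt βr →
        SmoothOnRegion ψ (Ici (2*M)) → CompactRSupport ψ →
        SolvesPerturbedRW M s ℓ ε βt βr ψ →
        ∀ τ : ℝ, 0 < τ →
          iNdeg M ℓ (Wc M ψ) 0 τ
            ≤ ENNReal.ofReal Ct *
                ((∫⁻ τ' in Ioc (0:ℝ) τ, ∫⁻ r in Ioi (2*M),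
                    ENNReal.ofReal ((pt (Wc M ψ) τ' r)^2 / (r * Dc M r)))
                  + iNdegBar M ℓ ψ 0 τ
                  + eE M ℓ (Wc M ψ) τ + eE M ℓ (Wc M ψ) 0
                  + eEbar M ℓ ψ τ + eEbar M ℓ ψ 0) := by
  obtain ⟨l, m, A, hl, hm, hA, key⟩ := exists_pointwise_estimate hM hC hs
  have hB : 0 ≤ m * (3 * l + 20) := by positivity
  refine ⟨A + m * (3 * l + 20) + 1, by positivity, ?_⟩
  intro ℓ _ ε hε hε1 βt βr ψ hβt hβr hβ hψ hsupp hsol τ hτ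
  have hψ' : SmoothOnRegion ψ (Ioi (2*M)) := hψ.mono Ioi_subset_Ici_self
  have hΦ : SmoothOnRegion (Wc M ψ) (Ioi (2*M)) := hψ'.Wc hM
  obtain ⟨R, hR⟩ := hsupp (-1) (τ + 1)
  obtain ⟨K, -, hK⟩ := exists_abs_currentCr_le hM hψ l m 0 τ (2*M + 1)
  have pos {r : ℝ} (hr : 2*M < r) : 0 < r := by linarith
  have cD : ContinuousOn (Dc M) (Ioi (2*M)) := (contDiffOn_Dc hM).continuousOn
  have c1 : ContinuousOn (fun _ : ℝ => (1 : ℝ)) (Ioi (2*M)) := continuousOn_const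
  have cg := continuousOn_energy_density hM cD ((ℓ : ℝ) * ((ℓ : ℝ) + 1)) 2 3 hΦ
  have ch₁ : ContinuousOn (Function.uncurry fun t r => pt (Wc M ψ) t r^2/(r * Dc M r))
      (univ ×ˢ Ioi (2*M)) :=
    (hΦ.pt.continuousOn.pow 2).div
      ((continuousOn_id.mul cD).comp continuousOn_snd fun _ hx => hx.2)
      fun x hx => (mul_pos (pos hx.2) (Dc_pos hM hx.2)).ne'
  have ch₂ : ContinuousOn (Function.uncurry fun t r => pt ψ t r^2/r^2 + pr ψ t r^2/r^2
      + (ℓ : ℝ) * ((ℓ : ℝ) + 1) * ψ t r^2/r^3 + ψ t r^2/r^3) (univ ×ˢ Ioi (2*M)) := by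
    simpa only [one_mul] using continuousOn_energy_density hM c1 ((ℓ : ℝ) * ((ℓ : ℝ) + 1)) 2 3 hψ'
  have ce₁ : ContinuousOn (Function.uncurry fun t r => pt (Wc M ψ) t r^2
      + Dc M r * pr (Wc M ψ) t r^2 + (ℓ : ℝ) * ((ℓ : ℝ) + 1) * Wc M ψ t r^2/r^2
      + Wc M ψ t r^2/r^2) (univ ×ˢ Ioi (2*M)) := by
    simpa only [pow_zero, div_one] using
      continuousOn_energy_density hM cD ((ℓ : ℝ) * ((ℓ : ℝ) + 1)) 0 2 hΦ
  have ce₂ : ContinuousOn (Function.uncurry fun t r => pt ψ t r^2 + pr ψ t r^2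
      + (ℓ : ℝ) * ((ℓ : ℝ) + 1) * ψ t r^2/r^2 + ψ t r^2/r^2) (univ ×ˢ Ioi (2*M)) := by
    simpa only [pow_zero, div_one, one_mul] using
      continuousOn_energy_density hM c1 ((ℓ : ℝ) * ((ℓ : ℝ) + 1)) 0 2 hψ'
  have main := lintegral_le_of_pointwise hτ.le hA hB cg (continuousOn_uncurry_add ch₁ ch₂)
    (continuousOn_uncurry_add ce₁ ce₂)
    (fun t r hr => by
      have := pos hr
      have := Dc_pos hM hr
      positivity)
    (fun t r hr => by
      have := pos hr
      have := Dc_pos hM hr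
      positivity)
    (fun t r hr => by
      have := pos hr
      have := Dc_pos hM hr
      positivity)
    (smoothOnRegion_currentCt hM hψ' l m) (smoothOnRegion_currentCr hM hψ' l m)
    (key ℓ ε hε hε1 βt βr ψ hβt hβr hβ hψ' hsol)
    (fun t r hr => abs_currentCt_le ℓ hM hr hl hm t)
    (fun t ht r hr hRr => currentCr_eq_zero hM hr hR hRr
      ⟨by linarith [ht.1], by linarith [ht.2]⟩ l m)
    (by
      have := (tendsto_qc hM).const_mul K
      rwa [mul_zero] at this)
    hK
  have hbulk := lintegral_region_add_le (T := τ) ch₁ ch₂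
  have hslice := fun t => lintegral_slice_add_le (g := fun r => pt ψ t r^2 + pr ψ t r^2
    + (ℓ : ℝ) * ((ℓ : ℝ) + 1) * ψ t r^2/r^2 + ψ t r^2/r^2) (continuousOn_slice ce₁ t)
  have hA' : ENNReal.ofReal A ≤ ENNReal.ofReal (A + m * (3 * l + 20) + 1) :=
    ENNReal.ofReal_le_ofReal (by linarith)
  have hB' : ENNReal.ofReal (m * (3 * l + 20)) ≤ ENNReal.ofReal (A + m * (3 * l + 20) + 1) :=
    ENNReal.ofReal_le_ofReal (by linarith)
  calc iNdeg M ℓ (Wc M ψ) 0 τ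
      ≤ ENNReal.ofReal (A + m * (3 * l + 20) + 1) *
          ((∫⁻ τ' in Ioc (0:ℝ) τ, ∫⁻ r in Ioi (2*M),
              ENNReal.ofReal ((pt (Wc M ψ) τ' r)^2 / (r * Dc M r))) + iNdegBar M ℓ ψ 0 τ)
        + ENNReal.ofReal (A + m * (3 * l + 20) + 1) *
          ((eE M ℓ (Wc M ψ) τ + eEbar M ℓ ψ τ) + (eE M ℓ (Wc M ψ) 0 + eEbar M ℓ ψ 0)) :=
      main.trans (add_le_add (mul_le_mul' hA' hbulk)
        (mul_le_mul' hB' (add_le_add (hslice τ) (hslice 0))))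
    _ = _ := by
      rw [← mul_add]
      congr 1
      abel
end
end

section
/- (Regularity of the rescaled commutator vector field at the horizon.) Let f(r) = (1 − 3M/r)√(1 + 6M/r) and D(r) = 1 − 2M/r. Then the function g(r) = (2M/r + f(r)) / D(r), defined for r > 2M, extends to a smooth function on [2M, ∞), and g is bounded on (2M, ∞); equivalently, 2M/r + f(r) vanishes at r = 2M to at least first order in (r − 2M), so that the vector field D^{−1/2} W = (r/D) ( D ∂_r + (2M/r + f) ∂_t ) has coefficients extending smoothly to the event horizon r = 2M. -/
open MeasureTheory Set
open scoped ENNReal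

noncomputable section

/-- With `s = √(1 + 6M/r)`, the quotient `(2M/r + f)/D` is a rational function of `s`
without a pole for `s ≥ 0`. -/
lemma div_Dc_eq_rational_sqrt {M r : ℝ} (hM : 0 < M) (hr : 2*M < r) :
    (2*M/r + fc M r) / Dc M r =
      (3 * Real.sqrt (1 + 6*M/r)^2 + 4 * Real.sqrt (1 + 6*M/r) - 1) /
        (2 * (2 + Real.sqrt (1 + 6*M/r))) := by
  have hr0 : 0 < r := by linarith
  have hD : Dc M r ≠ 0 := by
    have : 2*M/r < 1 := (div_lt_one hr0).2 hr
    unfold Dc; linarith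
  have hs : Real.sqrt (1 + 6*M/r)^2 = 1 + 6*M/r := Real.sq_sqrt (by positivity)
  have hs0 := Real.sqrt_nonneg (1 + 6*M/r)
  rw [div_eq_div_iff hD (by positivity)]
  unfold fc Dc
  generalize Real.sqrt (1 + 6*M/r) = s at *
  have h1 : M/r = (s^2 - 1)/6 := by rw [hs]; ring
  rw [mul_div_assoc 2 M r, mul_div_assoc 3 M r, h1]
  ring

lemma contDiffOn_rational_sqrt {M : ℝ} (hM : 0 < M) :
    ContDiffOn ℝ (⊤ : ℕ∞) (fun r : ℝ =>
      (3 * Real.sqrt (1 + 6*M/r)^2 + 4 * Real.sqrt (1 + 6*M/r) - 1) /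
        (2 * (2 + Real.sqrt (1 + 6*M/r)))) (Ici (2*M)) := by
  have hpos : ∀ r ∈ Ici (2*M), 0 < r := fun r hr => by
    have : 2*M ≤ r := hr
    linarith
  have hs : ContDiffOn ℝ (⊤ : ℕ∞) (fun r : ℝ => Real.sqrt (1 + 6*M/r)) (Ici (2*M)) := by
    refine ContDiffOn.sqrt (contDiffOn_const.add
      (contDiffOn_const.div contDiffOn_id fun r hr => (hpos r hr).ne')) fun r hr => ?_
    have := hpos r hr
    positivity
  refine ContDiffOn.div (((contDiffOn_const.mul (hs.pow 2)).add
    (contDiffOn_const.mul hs)).sub contDiffOn_const)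
    (contDiffOn_const.mul (contDiffOn_const.add hs)) fun r _ => ?_
  positivity

/-- **Regularity of the rescaled commutator vector field at the horizon:**
the coefficient `g(r) = (2M/r + f(r))/D(r)` of `∂_t` in `D^{-1/2} W = (r/D)(D ∂_r + (2M/r + f) ∂_t)`
extends smoothly to `[2M,∞)` and is bounded on `(2M,∞)`. -/
theorem horizon_regularity (M : ℝ) (hM : 0 < M) :
    ∃ g : ℝ → ℝ, ContDiffOn ℝ (⊤ : ℕ∞) g (Ici (2*M)) ∧
      (∀ r : ℝ, 2*M < r → g r = (2*M/r + fc M r) / Dc M r) ∧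
      ∃ B : ℝ, ∀ r : ℝ, 2*M < r → |(2*M/r + fc M r) / Dc M r| ≤ B := by
  refine ⟨_, contDiffOn_rational_sqrt hM, fun r hr => (div_Dc_eq_rational_sqrt hM hr).symm,
    5, fun r hr => ?_⟩
  rw [div_Dc_eq_rational_sqrt hM hr]
  have hr0 : 0 < r := by linarith
  have hs0 := Real.sqrt_nonneg (1 + 6*M/r)
  have hs2 : Real.sqrt (1 + 6*M/r) ≤ 2 := by
    rw [Real.sqrt_le_left (by norm_num)]
    have : 6*M/r ≤ 3 := (div_le_iff₀ hr0).2 (by linarith)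
    linarith
  generalize Real.sqrt (1 + 6*M/r) = s at *
  rw [abs_le, le_div_iff₀ (by positivity), div_le_iff₀ (by positivity)]
  constructor <;> nlinarith
end
end
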